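/- For every δ ∈ (0,1/2] there exists a constant c > 0 such that for every p ∈ [δ,1/2], every n ≥ 3, every ε ≥ 0, and every odd-cycle-intersecting family F of subgraphs of K_n with μ_p(F) ≥ p^3 − ε, there exists a △umvirate T (a family {G ⊆ E_n : T ⊆ G} for a fixed triangle T) such that μ_p(F Δ T) ≤ c·ε, where F Δ T denotes the symmetric difference of the two families. -/

import Mathlib

/-- The edge set of the complete graph `K_n` on vertex set `Fin n`:
all non-diagonal unordered pairs. -/
def edgeFinset (n : ℕ) : Finset (Sym2 (Fin n)) :=
  Finset.univ.filter (fun e => ¬ e.IsDiag)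

/-- `T` is a triangle: the three edges on three distinct vertices. -/
def IsTriangle {n : ℕ} (T : Finset (Sym2 (Fin n))) : Prop :=
  ∃ a b c : Fin n, a ≠ b ∧ a ≠ c ∧ b ≠ c ∧ T = {s(a, b), s(a, c), s(b, c)}

/-- The simple graph on `Fin n` with edge set `G`. -/
def graphOf {n : ℕ} (G : Finset (Sym2 (Fin n))) : SimpleGraph (Fin n) :=
  SimpleGraph.fromEdgeSet (G : Set (Sym2 (Fin n)))

/-- The graph `G` contains a cycle of odd length. -/
def HasOddCycle {n : ℕ} (G : Finset (Sym2 (Fin n))) : Prop :=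
  ∃ (v : Fin n) (w : (graphOf G).Walk v v), w.IsCycle ∧ Odd w.length

/-- A family of graphs is odd-cycle-intersecting if the intersection of any
two members contains an odd cycle. -/
def OddCycleIntersecting {n : ℕ} (F : Finset (Finset (Sym2 (Fin n)))) : Prop :=
  ∀ G ∈ F, ∀ H ∈ F, HasOddCycle (G ∩ H)

/-- The `p`-biased measure of a graph `G ⊆ E_n`. -/
noncomputable def muP (n : ℕ) (p : ℝ) (G : Finset (Sym2 (Fin n))) : ℝ :=
  p ^ G.card * (1 - p) ^ (n.choose 2 - G.card)

/-- The `p`-biased measure of a family of graphs. -/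
noncomputable def muPFam (n : ℕ) (p : ℝ) (F : Finset (Finset (Sym2 (Fin n)))) : ℝ :=
  ∑ G ∈ F, muP n p G

namespace BooleanCube

section Fourier

variable {α : Type*} [Fintype α]

/-- The average of a function over the discrete cube `Finset α`. -/
noncomputable def avg (f : Finset α → ℝ) : ℝ :=
  (∑ x, f x) / 2 ^ Fintype.card α

lemma avg_add (f g : Finset α → ℝ) : avg (fun x => f x + g x) = avg f + avg g := by
  simp [avg, Finset.sum_add_distrib, add_div]

lemma avg_sub (f g : Finset α → ℝ) : avg (fun x => f x - g x) = avg f - avg g := by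
  simp [avg, Finset.sum_sub_distrib, sub_div]

lemma avg_const_mul (c : ℝ) (f : Finset α → ℝ) : avg (fun x => c * f x) = c * avg f := by
  simp [avg, ← Finset.mul_sum, mul_div_assoc]

lemma avg_mul_const (c : ℝ) (f : Finset α → ℝ) : avg (fun x => f x * c) = avg f * c := by
  simp [avg, ← Finset.sum_mul, div_mul_eq_mul_div]

lemma avg_const (c : ℝ) : avg (fun _ : Finset α => c) = c := by
  simp [avg]

lemma avg_sum {κ : Type*} (s : Finset κ) (f : κ → Finset α → ℝ) :
    avg (fun x => ∑ k ∈ s, f k x) = ∑ k ∈ s, avg (f k) := by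
  simp only [avg]
  rw [Finset.sum_comm, Finset.sum_div]

lemma avg_mono {f g : Finset α → ℝ} (h : ∀ x, f x ≤ g x) : avg f ≤ avg g := by
  unfold avg
  gcongr with x
  exact h x

lemma avg_nonneg {f : Finset α → ℝ} (h : ∀ x, 0 ≤ f x) : 0 ≤ avg f := by
  unfold avg
  exact div_nonneg (Finset.sum_nonneg fun x _ => h x) (by positivity)

lemma avg_comp_equiv (e : Finset α ≃ Finset α) (f : Finset α → ℝ) :
    avg (fun x => f (e x)) = avg f := by
  simp only [avg]
  rw [Equiv.sum_comp e f]

lemma avg_mul_sq_le (u v : Finset α → ℝ) :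
    avg (fun x => u x * v x) ^ 2 ≤ avg (fun x => u x ^ 2) * avg (fun x => v x ^ 2) := by
  have h := Finset.sum_mul_sq_le_sq_mul_sq (Finset.univ : Finset (Finset α)) u v
  have h2 : (0 : ℝ) < 2 ^ Fintype.card α := by positivity
  simp only [avg]
  rw [div_pow, div_mul_div_comm, ← pow_two]
  gcongr

variable [DecidableEq α]

/-- The Walsh character indexed by `S`. -/
def walsh (S x : Finset α) : ℝ :=
  ∏ i, if i ∈ S ∧ i ∈ x then -1 else 1

/-- The Fourier coefficient of `f` at `S`. -/
noncomputable def coeff (f : Finset α → ℝ) (S : Finset α) : ℝ :=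
  avg fun x => f x * walsh S x

/-- Translation of the cube by `a`. -/
def translate (a : Finset α) : Finset α ≃ Finset α :=
  Function.Involutive.toPerm (fun x => symmDiff x a) fun x => by simp

lemma avg_translate (a : Finset α) (f : Finset α → ℝ) :
    avg (fun x => f (symmDiff x a)) = avg f :=
  avg_comp_equiv (translate a) f

lemma walsh_comm (S x : Finset α) : walsh S x = walsh x S := by
  simp [walsh, and_comm]

lemma walsh_symmDiff_right (S x y : Finset α) :
    walsh S (symmDiff x y) = walsh S x * walsh S y := by
  simp only [walsh, ← Finset.prod_mul_distrib]
  refine Finset.prod_congr rfl fun i _ => ?_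
  by_cases h1 : i ∈ S <;> by_cases h2 : i ∈ x <;> by_cases h3 : i ∈ y <;>
    simp [Finset.mem_symmDiff, h1, h2, h3]

lemma walsh_symmDiff_left (S T x : Finset α) :
    walsh (symmDiff S T) x = walsh S x * walsh T x := by
  simp only [walsh_comm _ x, walsh_symmDiff_right]

lemma walsh_mul_self (S x : Finset α) : walsh S x * walsh S x = 1 := by
  rw [← walsh_symmDiff_right]
  simp [walsh]

lemma walsh_empty_left (x : Finset α) : walsh ∅ x = 1 := by simp [walsh]

lemma walsh_eq_prod (S x : Finset α) : walsh S x = ∏ i ∈ x, if i ∈ S then -1 else 1 := by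
  rw [walsh, ← Finset.prod_subset (Finset.subset_univ x)]
  · exact Finset.prod_congr rfl fun i hi => by simp [hi]
  · intro i _ hi
    simp [hi]

lemma walsh_singleton (S : Finset α) (i : α) : walsh S {i} = if i ∈ S then -1 else 1 := by
  rw [walsh_eq_prod, Finset.prod_singleton]

lemma walsh_univ (x : Finset α) : walsh Finset.univ x = (-1) ^ x.card := by
  simp [walsh_eq_prod]

lemma walsh_insert {i : α} {S : Finset α} (h : i ∉ S) (x : Finset α) :
    walsh (insert i S) x = walsh {i} x * walsh S x := by
  rw [← walsh_symmDiff_left]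
  congr 1
  ext j
  by_cases hj : j = i <;> simp [Finset.mem_symmDiff, hj, h]

lemma avg_walsh (S : Finset α) : avg (walsh S) = if S = ∅ then 1 else 0 := by
  split_ifs with h
  · subst h
    simp [avg_const, show walsh (∅ : Finset α) = fun _ => (1 : ℝ) from
      funext walsh_empty_left]
  · obtain ⟨i, hi⟩ := Finset.nonempty_iff_ne_empty.mpr h
    have := avg_translate {i} (walsh S)
    simp only [walsh_symmDiff_right, avg_mul_const, walsh_singleton, hi, if_true] at this
    linarith

lemma sum_walsh (x : Finset α) :
    ∑ S, walsh S x = if x = ∅ then (2 : ℝ) ^ Fintype.card α else 0 := by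
  have h := avg_walsh x
  simp only [avg, walsh_comm x] at h
  have h2 : (2 : ℝ) ^ Fintype.card α ≠ 0 := by positivity
  rw [div_eq_iff h2] at h
  rw [h]
  split_ifs <;> simp

lemma sum_coeff_mul_walsh (f : Finset α → ℝ) (x : Finset α) :
    ∑ S, coeff f S * walsh S x = f x := by
  have h2 : (2 : ℝ) ^ Fintype.card α ≠ 0 := by positivity
  have h : ∀ S, coeff f S * walsh S x =
      (∑ y, f y * walsh S (symmDiff y x)) / 2 ^ Fintype.card α := by
    intro S
    simp only [coeff, avg, walsh_symmDiff_right]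
    rw [div_mul_eq_mul_div, Finset.sum_mul]
    simp [mul_assoc]
  simp only [h]
  rw [← Finset.sum_div, Finset.sum_comm]
  simp only [← Finset.mul_sum, sum_walsh]
  rw [Finset.sum_eq_single x]
  · simp
  · intro y _ hy
    simp [← Finset.bot_eq_empty, symmDiff_eq_bot, hy]
  · simp

lemma avg_mul_eq_sum_coeff (f g : Finset α → ℝ) :
    avg (fun x => f x * g x) = ∑ S, coeff f S * coeff g S := by
  have h : (fun x => f x * g x) = fun x => ∑ S, coeff g S * (f x * walsh S x) := by
    funext x
    conv_lhs => rw [← sum_coeff_mul_walsh g x]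
    rw [Finset.mul_sum]
    exact Finset.sum_congr rfl fun S _ => by ring
  rw [h, avg_sum]
  refine Finset.sum_congr rfl fun S _ => ?_
  rw [avg_const_mul, mul_comm]
  rfl

lemma avg_sq_eq_sum_coeff_sq (f : Finset α → ℝ) :
    avg (fun x => f x ^ 2) = ∑ S, coeff f S ^ 2 := by
  simp only [pow_two, avg_mul_eq_sum_coeff]

lemma coeff_sum_walsh (c : Finset α → ℝ) (S : Finset α) :
    coeff (fun x => ∑ T, c T * walsh T x) S = c S := by
  simp only [coeff, Finset.sum_mul, mul_assoc, ← walsh_symmDiff_left]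
  rw [avg_sum]
  simp only [avg_const_mul, avg_walsh, ← Finset.bot_eq_empty, symmDiff_eq_bot]
  simp

lemma coeff_empty (f : Finset α → ℝ) : coeff f ∅ = avg f := by
  simp [coeff, walsh_empty_left]

lemma coeff_eq_zero_of_invariant {f : Finset α → ℝ} {i : α}
    (h : ∀ x, f (symmDiff x {i}) = f x) {S : Finset α} (hi : i ∈ S) : coeff f S = 0 := by
  have := avg_translate {i} fun x => f x * walsh S x
  simp only [h, walsh_symmDiff_right, walsh_singleton, hi, if_true, ← mul_assoc,
    avg_mul_const] at this
  unfold coeff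
  linarith

lemma avg_mul_translate (f : Finset α → ℝ) (a : Finset α) :
    avg (fun x => f x * f (symmDiff x a)) = ∑ S, coeff f S ^ 2 * walsh S a := by
  rw [avg_mul_eq_sum_coeff]
  refine Finset.sum_congr rfl fun S _ => ?_
  have : coeff (fun x => f (symmDiff x a)) S = coeff f S * walsh S a := by
    have := avg_translate a fun x => f (symmDiff x a) * walsh S x
    simp only [symmDiff_symmDiff_cancel_right, walsh_symmDiff_right] at this
    rw [coeff, ← this, coeff, ← avg_mul_const]
    congr 1
    funext x
    ring
  rw [this]
  ring

end Fourier

end BooleanCube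

namespace BooleanCube

section Hypercontractivity

variable {α : Type*} [Fintype α] [DecidableEq α]

/-- The polynomial of degree at most `d` in the variables `U` with coefficients `c`. -/
def lowPoly (U : Finset α) (d : ℕ) (c : Finset α → ℝ) (x : Finset α) : ℝ :=
  ∑ S ∈ U.powerset with S.card ≤ d, c S * walsh S x

lemma lowPoly_insert_zero {i : α} {U : Finset α} (hi : i ∉ U) (c : Finset α → ℝ)
    (x : Finset α) : lowPoly (insert i U) 0 c x = lowPoly U 0 c x := by
  unfold lowPoly
  congr 1
  ext S
  simp only [Finset.mem_filter, Finset.mem_powerset, Nat.le_zero, Finset.card_eq_zero]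
  constructor <;> rintro ⟨-, rfl⟩ <;> simp

lemma lowPoly_insert_succ {i : α} {U : Finset α} (hi : i ∉ U) (d : ℕ) (c : Finset α → ℝ)
    (x : Finset α) :
    lowPoly (insert i U) (d + 1) c x =
      lowPoly U (d + 1) c x + walsh {i} x * lowPoly U d (fun S => c (insert i S)) x := by
  unfold lowPoly
  rw [Finset.sum_filter, Finset.sum_powerset_insert hi, ← Finset.sum_filter, Finset.mul_sum,
    Finset.sum_filter (s := U.powerset) (p := fun S => S.card ≤ d)]
  congr 1
  refine Finset.sum_congr rfl fun S hS => ?_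
  have hS' : i ∉ S := fun h => hi (Finset.mem_powerset.mp hS h)
  rw [Finset.card_insert_of_notMem hS', walsh_insert hS']
  simp only [Nat.add_le_add_iff_right]
  split_ifs <;> ring

lemma lowPoly_invariant {i : α} {U : Finset α} (hi : i ∉ U) (d : ℕ) (c : Finset α → ℝ)
    (x : Finset α) : lowPoly U d c (symmDiff x {i}) = lowPoly U d c x := by
  refine Finset.sum_congr rfl fun S hS => ?_
  have hS' : i ∉ S := fun h => hi (Finset.mem_powerset.mp (Finset.mem_filter.mp hS).1 h)
  rw [walsh_symmDiff_right, walsh_singleton, if_neg hS', mul_one]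

/-- Bonami's lemma: the fourth moment of a polynomial of degree at most `d`. -/
lemma avg_lowPoly_pow_four_le (U : Finset α) (d : ℕ) (c : Finset α → ℝ) :
    avg (fun x => lowPoly U d c x ^ 4) ≤ 9 ^ d * avg (fun x => lowPoly U d c x ^ 2) ^ 2 := by
  induction U using Finset.induction_on generalizing d c with
  | empty =>
    have h : ∀ x, lowPoly (∅ : Finset α) d c x = c ∅ := by
      intro x
      simp [lowPoly, Finset.filter_singleton, walsh_empty_left]
    simp only [h, avg_const]
    have : (1 : ℝ) ≤ 9 ^ d := one_le_pow₀ (by norm_num)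
    nlinarith [pow_nonneg (sq_nonneg (c ∅)) 2]
  | insert i U hi ih =>
    cases d with
    | zero => simpa only [lowPoly_insert_zero hi] using ih 0 c
    | succ d =>
      set a := lowPoly U (d + 1) c with ha
      set b := lowPoly U d (fun S => c (insert i S)) with hb
      have hw : ∀ x : Finset α, walsh {i} x ^ 2 = 1 := fun x => by
        rw [pow_two, walsh_mul_self]
      have hodd : ∀ h : Finset α → ℝ, (∀ x, h (symmDiff x {i}) = h x) →
          avg (fun x => h x * walsh {i} x) = 0 := fun h hh =>
        coeff_eq_zero_of_invariant hh (Finset.mem_singleton_self i)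
      have hainv : ∀ x, a (symmDiff x {i}) = a x := lowPoly_invariant hi _ _
      have hbinv : ∀ x, b (symmDiff x {i}) = b x := lowPoly_invariant hi _ _
      have h2 : avg (fun x => lowPoly (insert i U) (d + 1) c x ^ 2) =
          avg (fun x => a x ^ 2) + avg (fun x => b x ^ 2) := by
        have := hodd (fun x => 2 * a x * b x) (fun x => by rw [hainv, hbinv])
        rw [← add_zero (avg (fun x => a x ^ 2) + _), ← this, ← avg_add, ← avg_add]
        congr 1
        funext x
        rw [lowPoly_insert_succ hi]
        linear_combination b x ^ 2 * hw x
      have h4 : avg (fun x => lowPoly (insert i U) (d + 1) c x ^ 4) =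
          avg (fun x => a x ^ 4) + 6 * avg (fun x => a x ^ 2 * b x ^ 2) +
            avg (fun x => b x ^ 4) := by
        have := hodd (fun x => 4 * a x ^ 3 * b x + 4 * a x * b x ^ 3)
          (fun x => by rw [hainv, hbinv])
        rw [← avg_const_mul, ← add_zero (_ + avg (fun x => b x ^ 4)), ← this, ← avg_add,
          ← avg_add, ← avg_add]
        congr 1
        funext x
        rw [lowPoly_insert_succ hi]
        linear_combination (6 * a x ^ 2 * b x ^ 2 + 4 * a x * walsh {i} x * b x ^ 3 +
          b x ^ 4 * (walsh {i} x ^ 2 + 1)) * hw x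
      have hA := ih (d + 1) c
      have hB := ih d fun S => c (insert i S)
      rw [← ha] at hA
      rw [← hb] at hB
      have hAB := avg_mul_sq_le (fun x => a x ^ 2) (fun x => b x ^ 2)
      simp only [← pow_mul, Nat.reduceMul] at hAB
      rw [h2, h4]
      set A := avg fun x => a x ^ 2
      set B := avg fun x => b x ^ 2
      have hA0 : 0 ≤ A := avg_nonneg fun x => sq_nonneg _
      have hB0 : 0 ≤ B := avg_nonneg fun x => sq_nonneg _
      have hB4 : 0 ≤ avg fun x => b x ^ 4 := avg_nonneg fun x => by positivity
      have hmix : avg (fun x => a x ^ 2 * b x ^ 2) ≤ 3 * 9 ^ d * (A * B) := by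
        refine abs_le_of_sq_le_sq' ?_ (by positivity) |>.2
        calc _ ≤ _ := hAB
          _ ≤ (9 ^ (d + 1) * A ^ 2) * (9 ^ d * B ^ 2) := by gcongr
          _ = _ := by ring
      have h9 : (0 : ℝ) < 9 ^ d := by positivity
      calc _ ≤ 9 ^ (d + 1) * A ^ 2 + 6 * (3 * 9 ^ d * (A * B)) + 9 ^ d * B ^ 2 := by gcongr
        _ ≤ 9 ^ (d + 1) * (A + B) ^ 2 := by
          have : 0 ≤ 9 ^ d * B ^ 2 := by positivity
          rw [pow_succ]
          nlinarith

end Hypercontractivity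

end BooleanCube

namespace BooleanCube

section Junta

variable {α : Type*} [Fintype α] [DecidableEq α]

/-- The function obtained from `f` by averaging over the coordinates in `I`. -/
noncomputable def smooth (I : Finset α) (f : Finset α → ℝ) (x : Finset α) : ℝ :=
  avg fun y => f ((x \ I) ∪ (y ∩ I))

/-- The Fourier weight of `f` on the sets that meet `I`. -/
noncomputable def variation (I : Finset α) (f : Finset α → ℝ) : ℝ :=
  ∑ S, if Disjoint S I then 0 else coeff f S ^ 2

/-- The Fourier weight of `f` above level three. -/
noncomputable def tail (f : Finset α → ℝ) : ℝ :=
  ∑ S, if S.card ≤ 3 then 0 else coeff f S ^ 2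

lemma smooth_walsh (I S x : Finset α) :
    smooth I (walsh S) x = if Disjoint S I then walsh S x else 0 := by
  have h : ∀ y : Finset α, walsh S ((x \ I) ∪ (y ∩ I)) = walsh (S \ I) x * walsh (S ∩ I) y := by
    intro y
    simp only [walsh, ← Finset.prod_mul_distrib]
    refine Finset.prod_congr rfl fun i _ => ?_
    by_cases h1 : i ∈ S <;> by_cases h2 : i ∈ x <;> by_cases h3 : i ∈ y <;>
      by_cases h4 : i ∈ I <;> simp [h1, h2, h3, h4]
  simp only [smooth, h, avg_const_mul, avg_walsh, Finset.disjoint_iff_inter_eq_empty]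
  split_ifs with h0
  · rw [Finset.sdiff_eq_self_of_disjoint (Finset.disjoint_iff_inter_eq_empty.mpr h0), mul_one]
  · rw [mul_zero]

lemma smooth_eq_sum (I : Finset α) (f : Finset α → ℝ) (x : Finset α) :
    smooth I f x = ∑ S, (if Disjoint S I then coeff f S else 0) * walsh S x := by
  have : smooth I f x = ∑ S, coeff f S * smooth I (walsh S) x := by
    simp only [smooth, ← avg_const_mul, ← avg_sum]
    simp only [sum_coeff_mul_walsh]
  rw [this]
  refine Finset.sum_congr rfl fun S _ => ?_
  rw [smooth_walsh]
  split_ifs <;> simp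

lemma coeff_smooth (I : Finset α) (f : Finset α → ℝ) (S : Finset α) :
    coeff (smooth I f) S = if Disjoint S I then coeff f S else 0 := by
  rw [show smooth I f = fun x => _ from funext (smooth_eq_sum I f), coeff_sum_walsh]

lemma avg_smooth (I : Finset α) (f : Finset α → ℝ) : avg (smooth I f) = avg f := by
  rw [← coeff_empty, coeff_smooth]
  simp [coeff_empty]

lemma avg_mul_smooth (I : Finset α) (f g : Finset α → ℝ) :
    avg (fun x => f x * smooth I g x) = avg (fun x => smooth I f x * smooth I g x) := by
  simp only [avg_mul_eq_sum_coeff, coeff_smooth]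
  refine Finset.sum_congr rfl fun S _ => ?_
  split_ifs <;> simp

lemma smooth_nonneg {f : Finset α → ℝ} (h : ∀ x, 0 ≤ f x) (I x : Finset α) :
    0 ≤ smooth I f x :=
  avg_nonneg fun _ => h _

lemma smooth_le_one {f : Finset α → ℝ} (h : ∀ x, f x ≤ 1) (I x : Finset α) :
    smooth I f x ≤ 1 :=
  (avg_mono fun _ => h _).trans_eq (avg_const 1)

lemma smooth_mono {f : Finset α → ℝ} (h : Monotone f) (I : Finset α) : Monotone (smooth I f) :=
  fun _ _ hxy => avg_mono fun _ =>
    h (Finset.union_subset_union (Finset.sdiff_subset_sdiff hxy subset_rfl) subset_rfl)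

lemma smooth_sdiff (I x : Finset α) (f : Finset α → ℝ) :
    smooth I f (x \ I) = smooth I f x := by
  simp [smooth]

lemma avg_smooth_mul_one_sub {f : Finset α → ℝ} (hf : ∀ x, f x = 0 ∨ f x = 1) (I : Finset α) :
    avg (fun x => smooth I f x * (1 - smooth I f x)) = variation I f := by
  have h1 : avg (fun x => f x ^ 2) = avg f := by
    congr 1
    funext x
    rcases hf x with h | h <;> simp [h]
  have h2 := avg_sq_eq_sum_coeff_sq (smooth I f)
  have h3 : avg (fun x => f x ^ 2) = avg (fun x => smooth I f x ^ 2) + variation I f := by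
    rw [avg_sq_eq_sum_coeff_sq, h2, variation, ← Finset.sum_add_distrib]
    refine Finset.sum_congr rfl fun S _ => ?_
    rw [coeff_smooth]
    split_ifs <;> simp
  simp only [mul_sub, mul_one, ← pow_two, avg_sub]
  rw [show avg (fun x => smooth I f x) = avg f from avg_smooth I f]
  linarith

lemma variation_nonneg (I : Finset α) (f : Finset α → ℝ) : 0 ≤ variation I f :=
  Finset.sum_nonneg fun S _ => by split_ifs <;> positivity

lemma tail_nonneg (f : Finset α → ℝ) : 0 ≤ tail f :=
  Finset.sum_nonneg fun S _ => by split_ifs <;> positivity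

lemma variation_insert_le (i : α) (I : Finset α) (f : Finset α → ℝ) :
    variation (insert i I) f ≤ variation {i} f + variation I f := by
  unfold variation
  rw [← Finset.sum_add_distrib]
  refine Finset.sum_le_sum fun S _ => ?_
  have := sq_nonneg (coeff f S)
  by_cases h1 : i ∈ S <;> by_cases h2 : Disjoint S I <;> simp [h1, h2, this]

lemma avg_weighted_sq_le (u v : Finset α → ℝ) :
    avg (fun x => |u x| * v x) ^ 2 ≤ avg (fun x => |u x|) * avg (fun x => |u x| * v x ^ 2) := by
  have h := avg_mul_sq_le (fun x => √|u x|) (fun x => √|u x| * v x)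
  have h1 : ∀ x, √|u x| ^ 2 = |u x| := fun x => Real.sq_sqrt (abs_nonneg _)
  simp only [← mul_assoc, Real.mul_self_sqrt (abs_nonneg _), mul_pow, h1] at h
  exact h

/-- The variation of a Boolean function of nearly degree three is either tiny or bounded below. -/
lemma variation_gap {f : Finset α → ℝ} (hf : ∀ x, f x = 0 ∨ f x = 1) (I : Finset α) :
    variation I f ≤ 2 * tail f ∨ 1 / 23328 ≤ variation I f := by
  set V := variation I f with hV
  set m := smooth I f with hm
  set c : Finset α → ℝ := fun S => if Disjoint S I then 0 else coeff f S with hc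
  set g := lowPoly Finset.univ 3 c with hg
  set Y := ∑ S, (if S.card ≤ 3 then c S ^ 2 else 0) with hY
  have hm0 : ∀ x, 0 ≤ m x := smooth_nonneg (fun x => by rcases hf x with h | h <;> simp [h]) I
  have hm1 : ∀ x, m x ≤ 1 := smooth_le_one (fun x => by rcases hf x with h | h <;> simp [h]) I
  have hgc : ∀ S, coeff g S = if S.card ≤ 3 then c S else 0 := by
    intro S
    have : g = fun x => ∑ S, (if S.card ≤ 3 then c S else 0) * walsh S x := by
      funext x
      simp [hg, lowPoly, Finset.sum_filter]
    rw [this, coeff_sum_walsh]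
  have hfc : ∀ S, coeff (fun x => f x - m x) S = c S := by
    intro S
    have : coeff (fun x => f x - m x) S = coeff f S - coeff m S := by
      simp [coeff, sub_mul, avg_sub]
    rw [this, hm, coeff_smooth, hc]
    dsimp only
    split_ifs <;> simp
  have hfg : avg (fun x => (f x - m x) * g x) = Y := by
    rw [avg_mul_eq_sum_coeff]
    refine Finset.sum_congr rfl fun S _ => ?_
    rw [hfc, hgc]
    split_ifs <;> ring
  have hgg : avg (fun x => g x ^ 2) = Y := by
    rw [avg_sq_eq_sum_coeff_sq]
    refine Finset.sum_congr rfl fun S _ => ?_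
    rw [hgc]
    split_ifs <;> ring
  have habs : avg (fun x => |f x - m x|) = 2 * V := by
    have h : ∀ x, |f x - m x| = f x - 2 * (f x * m x) + m x := by
      intro x
      rcases hf x with h | h
      · rw [h, zero_sub, abs_neg, abs_of_nonneg (hm0 x)]; ring
      · rw [h, abs_of_nonneg (by linarith [hm1 x])]; ring
    have h2 := avg_smooth_mul_one_sub hf I
    simp only [mul_sub, mul_one, avg_sub] at h2
    simp only [h, avg_add, avg_sub, avg_const_mul]
    have h3 := avg_mul_smooth I f f
    have h4 := avg_smooth I f
    rw [← hm] at h2 h3 h4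
    change avg m - _ = _ at h2
    change avg f - 2 * _ + avg m = _
    linarith
  have hY0 : 0 ≤ Y := Finset.sum_nonneg fun S _ => by split_ifs <;> positivity
  have hV0 : 0 ≤ V := variation_nonneg I f
  have h4 := avg_lowPoly_pow_four_le Finset.univ 3 c
  rw [← hg, hgg] at h4
  set Q := avg fun x => |f x - m x| * g x ^ 2 with hQ
  have hY2 : Y ^ 2 ≤ 2 * V * Q := by
    have h1 : Y ≤ avg fun x => |f x - m x| * |g x| := by
      rw [← hfg]
      refine avg_mono fun x => ?_
      rw [← abs_mul]
      exact le_abs_self _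
    have h2 := avg_weighted_sq_le (fun x => f x - m x) (fun x => |g x|)
    simp only [sq_abs, habs] at h2
    exact (pow_le_pow_left₀ hY0 h1 2).trans h2
  have hQ2 : Q ^ 2 ≤ 2 * V * (9 ^ 3 * Y ^ 2) := by
    have h2 := avg_weighted_sq_le (fun x => f x - m x) (fun x => g x ^ 2)
    simp only [← pow_mul, Nat.reduceMul, habs] at h2
    refine h2.trans (mul_le_mul_of_nonneg_left (le_trans (avg_mono fun x => ?_) h4)
      (by positivity))
    refine mul_le_of_le_one_left (by positivity) (abs_le.mpr ?_)
    rcases hf x with h | h <;> rw [h] <;> constructor <;> linarith [hm0 x, hm1 x]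
  have hVY : V ≤ Y + tail f := by
    rw [hV, variation, hY, tail, ← Finset.sum_add_distrib]
    refine Finset.sum_le_sum fun S _ => ?_
    simp only [hc]
    have := sq_nonneg (coeff f S)
    split_ifs <;> simp [this]
  by_cases hcase : V ≤ 2 * tail f
  · exact Or.inl hcase
  right
  push Not at hcase
  have hYV : V / 2 < Y := by linarith
  have hVpos : 0 < V := lt_of_le_of_lt (by linarith [tail_nonneg f]) hcase
  have hYpos : 0 < Y := by linarith
  have hQ0 : 0 ≤ Q := avg_nonneg fun x => by positivity
  have h5 : Y ^ 2 * Y ^ 2 ≤ 5832 * V ^ 3 * Y ^ 2 := by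
    calc Y ^ 2 * Y ^ 2 ≤ (2 * V * Q) * (2 * V * Q) := by gcongr
      _ = 4 * V ^ 2 * Q ^ 2 := by ring
      _ ≤ 4 * V ^ 2 * (2 * V * (9 ^ 3 * Y ^ 2)) := by gcongr
      _ = _ := by ring
  have h6 : Y ^ 2 ≤ 5832 * V ^ 3 := le_of_mul_le_mul_right h5 (by positivity)
  have h7 : V ^ 2 * 1 ≤ V ^ 2 * (23328 * V) := by nlinarith
  have h8 : 1 ≤ 23328 * V := le_of_mul_le_mul_left h7 (by positivity)
  linarith

end Junta

end BooleanCube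

namespace BooleanCube

section Structure

variable {α : Type*} [Fintype α] [DecidableEq α]

/-- The coordinates on which `f` varies substantially. -/
noncomputable def influential (f : Finset α → ℝ) : Finset α :=
  Finset.univ.filter fun i => 1 / 23328 ≤ variation {i} f

lemma sum_coeff_sq_le_one {f : Finset α → ℝ} (hf : ∀ x, f x = 0 ∨ f x = 1) :
    ∑ S, coeff f S ^ 2 ≤ 1 := by
  rw [← avg_sq_eq_sum_coeff_sq]
  refine (avg_mono fun x => ?_).trans_eq (avg_const 1)
  rcases hf x with h | h <;> simp [h]

lemma card_influential_le {f : Finset α → ℝ} (hf : ∀ x, f x = 0 ∨ f x = 1)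
    (ht : tail f ≤ 1 / 46656) : (influential f).card ≤ 139968 := by
  have h1 : ∀ i ∈ influential f, 1 / 46656 ≤
      ∑ S, if i ∈ S ∧ S.card ≤ 3 then coeff f S ^ 2 else 0 := by
    intro i hi
    have hi' : 1 / 23328 ≤ variation {i} f := (Finset.mem_filter.mp hi).2
    have : variation {i} f ≤
        (∑ S, if i ∈ S ∧ S.card ≤ 3 then coeff f S ^ 2 else 0) + tail f := by
      rw [variation, tail, ← Finset.sum_add_distrib]
      refine Finset.sum_le_sum fun S _ => ?_
      have := sq_nonneg (coeff f S)
      by_cases h1 : i ∈ S <;> by_cases h2 : S.card ≤ 3 <;> simp [h1, h2, this]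
    linarith
  have h2 : ∑ i ∈ influential f, (∑ S, if i ∈ S ∧ S.card ≤ 3 then coeff f S ^ 2 else 0) ≤ 3 := by
    rw [Finset.sum_comm]
    calc _ ≤ ∑ S, 3 * coeff f S ^ 2 := by
          refine Finset.sum_le_sum fun S _ => ?_
          by_cases hS : S.card ≤ 3
          · simp only [hS, and_true]
            rw [← Finset.sum_filter, Finset.sum_const, nsmul_eq_mul]
            refine mul_le_mul_of_nonneg_right ?_ (sq_nonneg _)
            have : ((influential f).filter (· ∈ S)).card ≤ S.card :=
              Finset.card_le_card fun i hi => (Finset.mem_filter.mp hi).2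
            exact_mod_cast this.trans hS
          · simp [hS, sq_nonneg]
      _ ≤ 3 := by
          rw [← Finset.mul_sum]
          linarith [sum_coeff_sq_le_one hf]
  have h3 := (Finset.card_nsmul_le_sum _ _ _ h1).trans h2
  rw [nsmul_eq_mul] at h3
  have : ((influential f).card : ℝ) ≤ 139968 := by linarith
  exact_mod_cast this

lemma variation_compl_influential_le {f : Finset α → ℝ} (hf : ∀ x, f x = 0 ∨ f x = 1)
    (ht : tail f < 1 / 93312) : variation (influential f)ᶜ f ≤ 2 * tail f := by
  suffices h : ∀ I ⊆ (influential f)ᶜ, variation I f ≤ 2 * tail f from h _ subset_rfl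
  intro I
  induction I using Finset.induction_on with
  | empty =>
    intro _
    simp [variation, tail_nonneg]
  | insert i I _ ih =>
    intro hI
    have h1 := ih ((Finset.subset_insert i I).trans hI)
    have h2 : ¬ 1 / 23328 ≤ variation {i} f := by
      have := hI (Finset.mem_insert_self i I)
      simpa [influential] using this
    have h3 := (variation_gap hf {i}).resolve_right h2
    have h4 := variation_insert_le i I f
    exact (variation_gap hf (insert i I)).resolve_right (by linarith)

lemma le_avg_of_fiber {h : Finset α → ℝ} (h0 : ∀ x, 0 ≤ h x) (J : Finset α)
    (hJ : ∀ x, h (x \ Jᶜ) = h x) (x : Finset α) : h x ≤ 2 ^ J.card * avg h := by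
  have hinj : Set.InjOn (fun z => (x \ Jᶜ) ∪ z) (Jᶜ.powerset : Set (Finset α)) := by
    intro z hz w hw hzw
    simp only [Finset.coe_powerset, Set.mem_preimage, Set.mem_powerset_iff,
      Finset.coe_subset] at hz hw
    have key : ∀ v ⊆ Jᶜ, ((x \ Jᶜ) ∪ v) ∩ Jᶜ = v := fun v hv => by
      rw [Finset.union_inter_distrib_right, Finset.sdiff_inter_self, Finset.empty_union,
        Finset.inter_eq_left.mpr hv]
    rw [← key z hz, ← key w hw]
    exact congrArg (· ∩ Jᶜ) hzw
  have hval : ∀ z ∈ Jᶜ.powerset, h ((x \ Jᶜ) ∪ z) = h x := by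
    intro z hz
    rw [← hJ, ← hJ x]
    congr 1
    rw [Finset.union_sdiff_distrib, Finset.sdiff_eq_empty_iff_subset.mpr
      (Finset.mem_powerset.mp hz), Finset.union_empty, Finset.sdiff_idem]
  have hsum : (2 : ℝ) ^ Jᶜ.card * h x ≤ ∑ y, h y := by
    calc (2 : ℝ) ^ Jᶜ.card * h x = ∑ z ∈ Jᶜ.powerset, h ((x \ Jᶜ) ∪ z) := by
          rw [Finset.sum_congr rfl hval]
          simp
      _ = ∑ y ∈ Jᶜ.powerset.image fun z => (x \ Jᶜ) ∪ z, h y := (Finset.sum_image hinj).symm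
      _ ≤ _ := Finset.sum_le_sum_of_subset_of_nonneg (Finset.subset_univ _) fun y _ _ => h0 y
  have hcard : (2 : ℝ) ^ Fintype.card α = 2 ^ J.card * 2 ^ Jᶜ.card := by
    rw [← pow_add, Finset.card_add_card_compl]
  have hcancel : 2 ^ J.card * ((∑ y, h y) / (2 ^ J.card * 2 ^ Jᶜ.card)) =
      (∑ y, h y) / 2 ^ Jᶜ.card := by field_simp
  rw [avg, hcard, hcancel, le_div_iff₀ (by positivity)]
  linarith

lemma sum_powerset_walsh (A S : Finset α) :
    ∑ B ∈ A.powerset, (-1) ^ B.card * walsh S B = if A ⊆ S then 2 ^ A.card else 0 := by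
  have h : ∀ B : Finset α, (-1) ^ B.card * walsh S B = ∏ i ∈ B, if i ∈ S then (1 : ℝ) else -1 := by
    intro B
    rw [walsh_eq_prod, ← Finset.prod_const, ← Finset.prod_mul_distrib]
    refine Finset.prod_congr rfl fun i _ => ?_
    split_ifs <;> norm_num
  simp only [h, ← Finset.prod_one_add]
  split_ifs with hAS
  · rw [← Finset.prod_const]
    refine Finset.prod_congr rfl fun i hi => ?_
    rw [if_pos (hAS hi)]
    norm_num
  · obtain ⟨i, hi, hiS⟩ := Finset.not_subset.mp hAS
    exact Finset.prod_eq_zero hi (by simp [hiS])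

lemma avg_superset (A : Finset α) : avg (fun x => if A ⊆ x then (1 : ℝ) else 0) = 1 / 2 ^ A.card := by
  have : (Finset.univ.filter fun x => A ⊆ x) = Finset.Icc A Finset.univ := by
    ext x; simp
  rw [avg, ← Finset.sum_filter, Finset.sum_const, this, Finset.card_Icc_finset
    (Finset.subset_univ A), Finset.card_univ, nsmul_eq_mul, mul_one, Nat.cast_pow, Nat.cast_ofNat,
    div_eq_div_iff (by positivity) (by positivity), one_mul, ← pow_add,
    Nat.sub_add_cancel (Finset.card_le_univ A)]

lemma exists_inter_eq_of_half_lt_smooth {f : Finset α → ℝ} (hf : ∀ x, f x = 0 ∨ f x = 1)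
    {I A : Finset α} (hA : A \ I = A) (h : 1 / 2 < smooth I f A) :
    ∃ x y, f x = 1 ∧ f y = 1 ∧ x ∩ y = A := by
  by_contra! hne
  have hle : ∀ y : Finset α, f (A ∪ (y ∩ I)) + f (A ∪ (yᶜ ∩ I)) ≤ 1 := by
    intro y
    rcases hf (A ∪ (y ∩ I)) with h1 | h1 <;> rcases hf (A ∪ (yᶜ ∩ I)) with h2 | h2 <;>
      rw [h1, h2] <;> norm_num
    refine hne _ _ h1 h2 ?_
    ext i
    simp only [Finset.mem_inter, Finset.mem_union, Finset.mem_compl]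
    tauto
  have h1 := avg_mono hle
  rw [avg_const, avg_add] at h1
  have h2 := avg_comp_equiv (Function.Involutive.toPerm (fun y : Finset α => yᶜ) compl_involutive)
    fun y => f (A ∪ (y ∩ I))
  simp only [Function.Involutive.coe_toPerm] at h2
  rw [h2] at h1
  simp only [smooth, hA] at h
  linarith

/-- A minimal set on which the averaged function exceeds one half has at most three elements. -/
lemma card_le_three_of_minimal {f : Finset α → ℝ} {I A : Finset α} {t : ℝ}
    (hA : smooth I f A ≥ 1 - t) (hB : ∀ B ⊂ A, |smooth I f B| ≤ t)
    {M : ℕ} (hM : Iᶜ.card ≤ M) (hAI : A ⊆ Iᶜ) (ht : 2 ^ M * t ≤ 1 / 4)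
    (htail : tail f ≤ (1 / (4 * 4 ^ M)) ^ 2) : A.card ≤ 3 := by
  by_contra! hcard
  have hAM : A.card ≤ M := (Finset.card_le_card hAI).trans hM
  have ht0 : 0 ≤ t := by
    refine le_trans (abs_nonneg _) (hB ∅ ?_)
    exact Finset.empty_ssubset.mpr (Finset.card_pos.mp (by omega))
  have h1 : ∑ B ∈ A.powerset, (-1) ^ B.card * smooth I f B =
      ∑ S, (if Disjoint S I then coeff f S else 0) * (if A ⊆ S then 2 ^ A.card else 0) := by
    simp only [smooth_eq_sum, Finset.mul_sum]
    rw [Finset.sum_comm]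
    refine Finset.sum_congr rfl fun S _ => ?_
    rw [← sum_powerset_walsh, Finset.mul_sum]
    exact Finset.sum_congr rfl fun B _ => by ring
  have h2 : |∑ B ∈ A.powerset, (-1) ^ B.card * smooth I f B| ≤ 1 / 4 := by
    rw [h1]
    have hterm : ∀ S : Finset α, |(if Disjoint S I then coeff f S else 0) *
        (if A ⊆ S then 2 ^ A.card else 0)| ≤
        if S ∈ Iᶜ.powerset then 2 ^ M * (1 / (4 * 4 ^ M)) else 0 := by
      intro S
      have hiff : Disjoint S I ↔ S ∈ Iᶜ.powerset := by
        rw [Finset.mem_powerset, Finset.subset_compl_iff_disjoint_right]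
      by_cases hS : Disjoint S I
      · rw [if_pos hS, if_pos (hiff.mp hS)]
        by_cases hAS : A ⊆ S
        · have hS3 : ¬ S.card ≤ 3 := by
            have := Finset.card_le_card hAS
            omega
          have hcoef : coeff f S ^ 2 ≤ (1 / (4 * 4 ^ M)) ^ 2 := by
            refine le_trans ?_ htail
            have := Finset.single_le_sum (f := fun S : Finset α =>
              if S.card ≤ 3 then 0 else coeff f S ^ 2)
              (fun S _ => by split_ifs <;> positivity) (Finset.mem_univ S)
            simpa [hS3, tail] using this
          rw [if_pos hAS, abs_mul, mul_comm]
          have h2M : |(2 : ℝ) ^ A.card| ≤ 2 ^ M := by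
            rw [abs_of_pos (by positivity)]
            exact pow_le_pow_right₀ (by norm_num) hAM
          have := abs_le_of_sq_le_sq hcoef (by positivity)
          exact mul_le_mul h2M (abs_le.mpr (abs_le.mp this)) (abs_nonneg _) (by positivity)
        · rw [if_neg hAS, mul_zero, abs_zero]
          positivity
      · rw [if_neg hS, if_neg (fun h => hS (hiff.mpr h))]
        simp
    refine (Finset.abs_sum_le_sum_abs _ _).trans ((Finset.sum_le_sum fun S _ => hterm S).trans ?_)
    rw [Finset.sum_ite_mem, Finset.univ_inter, Finset.sum_const, Finset.card_powerset,
      nsmul_eq_mul, Nat.cast_pow, Nat.cast_ofNat]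
    calc (2 : ℝ) ^ Iᶜ.card * (2 ^ M * (1 / (4 * 4 ^ M)))
        ≤ 2 ^ M * (2 ^ M * (1 / (4 * 4 ^ M))) := by
          gcongr
          norm_num
      _ = 1 / 4 := by
          rw [show (4 : ℝ) = 2 * 2 by norm_num, mul_pow]
          field_simp
  have h3 : |∑ B ∈ A.powerset.erase A, (-1) ^ B.card * smooth I f B| ≤ 1 / 4 := by
    refine (Finset.abs_sum_le_sum_abs _ _).trans ?_
    calc _ ≤ ∑ B ∈ A.powerset.erase A, t := by
          refine Finset.sum_le_sum fun B hB' => ?_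
          rw [Finset.mem_erase, Finset.mem_powerset] at hB'
          rw [abs_mul, abs_pow, abs_neg, abs_one, one_pow, one_mul]
          exact hB B (Finset.ssubset_iff_subset_ne.mpr ⟨hB'.2, hB'.1⟩)
      _ ≤ 2 ^ M * t := by
          rw [Finset.sum_const, nsmul_eq_mul]
          refine mul_le_mul_of_nonneg_right ?_ ht0
          have : (A.powerset.erase A).card ≤ 2 ^ M :=
            (Finset.card_erase_le).trans (by
              rw [Finset.card_powerset]
              exact Nat.pow_le_pow_right (by norm_num) hAM)
          exact_mod_cast this
      _ ≤ 1 / 4 := ht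
  rw [← Finset.add_sum_erase _ _ (Finset.mem_powerset_self A)] at h2
  have h4 : |(-1) ^ A.card * smooth I f A| ≤ 1 / 2 := by
    rw [abs_le] at h2 h3 ⊢
    constructor <;> linarith
  rw [abs_mul, abs_pow, abs_neg, abs_one, one_pow, one_mul] at h4
  have h5 := (abs_le.mp h4).2
  have h6 : (1 : ℝ) ≤ 2 ^ M := one_le_pow₀ (by norm_num)
  nlinarith

/-- A monotone Boolean function that is nearly of degree three contains almost all of a subcube
fixing at most three coordinates. -/
theorem exists_subcube_of_small_tail : ∃ η : ℝ, 0 < η ∧ ∃ C : ℝ, 0 < C ∧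
    ∀ (α : Type) [Fintype α] [DecidableEq α] (f : Finset α → ℝ), (∀ x, f x = 0 ∨ f x = 1) →
      Monotone f → 1 / 16 ≤ avg f → tail f ≤ η →
      ∃ A : Finset α, A.card ≤ 3 ∧ (∃ x y, f x = 1 ∧ f y = 1 ∧ x ∩ y = A) ∧
        (1 - C * tail f) / 2 ^ A.card ≤ avg (fun x => if A ⊆ x then f x else 0) := by
  obtain ⟨M, hMdef⟩ : ∃ M : ℕ, M = 139968 := ⟨_, rfl⟩
  refine ⟨min (1 / 100000) ((1 / (4 * 4 ^ M)) ^ 2), by positivity, 4 * 2 ^ M, by positivity, ?_⟩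
  intro α _ _ f hf hmono havg htail
  have ht1 : tail f ≤ 1 / 100000 := htail.trans (min_le_left _ _)
  have ht2 : tail f ≤ (1 / (4 * 4 ^ M)) ^ 2 := htail.trans (min_le_right _ _)
  have ht0 := tail_nonneg f
  have hM : (influential f).card ≤ M := hMdef ▸ card_influential_le hf (by linarith)
  set I := (influential f)ᶜ with hI
  have hIc : Iᶜ = influential f := compl_compl _
  have hvar : variation I f ≤ 2 * tail f := variation_compl_influential_le hf (by linarith)
  have hm0 := smooth_nonneg (fun x => by rcases hf x with h | h <;> simp [h]) I (f := f)
  have hm1 := smooth_le_one (fun x => by rcases hf x with h | h <;> simp [h]) I (f := f)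
  have hmono' := smooth_mono hmono I
  set m := smooth I f with hm
  have hmI : ∀ x, m (x \ I) = m x := fun x => smooth_sdiff I x f
  have hprod := avg_smooth_mul_one_sub hf I
  rw [← hm] at hprod
  have hpt : ∀ x, m x * (1 - m x) ≤ 2 ^ M * (2 * tail f) := by
    intro x
    have := le_avg_of_fiber (h := fun x => m x * (1 - m x))
      (fun x => mul_nonneg (hm0 x) (by linarith [hm1 x])) (influential f)
      (fun x => by simp only [← hI, hmI]) x
    rw [hprod] at this
    refine this.trans (mul_le_mul (pow_le_pow_right₀ (by norm_num) hM) hvar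
      (variation_nonneg I f) (by positivity))
  have hex : (Finset.univ.filter fun x => 1 / 2 < m x).Nonempty := by
    by_contra hne
    rw [Finset.not_nonempty_iff_eq_empty, Finset.filter_eq_empty_iff] at hne
    have h1 : avg (fun x => m x * (1 / 2)) ≤ avg (fun x => m x * (1 - m x)) := by
      refine avg_mono fun x => mul_le_mul_of_nonneg_left ?_ (hm0 x)
      linarith [not_lt.mp (hne (Finset.mem_univ x))]
    rw [avg_mul_const, hprod] at h1
    have h2 : avg (fun x => m x) = avg f := avg_smooth I f
    linarith
  obtain ⟨A, hAmem, hAmin⟩ := Finset.exists_minimal hex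
  have hA : 1 / 2 < m A := (Finset.mem_filter.mp hAmem).2
  have hlt : ∀ B ⊂ A, m B ≤ 1 / 2 := by
    intro B hB
    by_contra! hcon
    exact hB.2 (hAmin (by simpa using hcon) hB.1)
  have hAI : A \ I = A := by
    by_contra hne
    have hss : A \ I ⊂ A := Finset.ssubset_iff_subset_ne.mpr ⟨Finset.sdiff_subset, hne⟩
    have := hlt _ hss
    rw [hmI] at this
    linarith
  have hAsub : A ⊆ Iᶜ := by
    rw [← hAI, Finset.sdiff_eq_inter_compl]
    exact Finset.inter_subset_right
  have hAlarge : 1 - 4 * 2 ^ M * tail f ≤ m A := by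
    have := hpt A
    nlinarith [hm1 A]
  have hcard : A.card ≤ 3 := by
    refine card_le_three_of_minimal (M := M) hAlarge (fun B hB => ?_) (hIc ▸ hM) hAsub ?_ ht2
    · rw [abs_of_nonneg (hm0 B)]
      have h1 := hpt B
      have h2 := hlt B hB
      nlinarith [hm0 B]
    · calc (2 : ℝ) ^ M * (4 * 2 ^ M * tail f) = 4 * 4 ^ M * tail f := by
            rw [show (4 : ℝ) ^ M = 2 ^ M * 2 ^ M by rw [← mul_pow]; norm_num]
            ring
        _ ≤ 4 * 4 ^ M * (1 / (4 * 4 ^ M)) ^ 2 := by gcongr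
        _ = 1 / (4 * 4 ^ M) := by field_simp
        _ ≤ 1 / 4 := by
            have : (1 : ℝ) ≤ 4 ^ M := one_le_pow₀ (by norm_num)
            rw [div_le_div_iff₀ (by positivity) (by norm_num)]
            linarith
  refine ⟨A, hcard, exists_inter_eq_of_half_lt_smooth hf hAI hA, ?_⟩
  have hcube : (fun x => if A ⊆ x then (1 : ℝ) else 0) =
      smooth I (fun x => if A ⊆ x then (1 : ℝ) else 0) := by
    funext x
    rw [smooth, ← avg_const (α := α) (if A ⊆ x then (1 : ℝ) else 0)]
    congr 1
    funext y
    have : A ⊆ x ↔ A ⊆ (x \ I) ∪ (y ∩ I) := by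
      have hdis : ∀ i ∈ A, i ∉ I := fun i hi => Finset.mem_compl.mp (hAsub hi)
      constructor
      · intro h i hi
        simp [h hi, hdis i hi]
      · intro h i hi
        have := h hi
        simp only [Finset.mem_union, Finset.mem_sdiff, Finset.mem_inter, hdis i hi] at this
        tauto
    simp only [this]
  have h1 : avg (fun x => if A ⊆ x then f x else 0) =
      avg (fun x => m x * if A ⊆ x then (1 : ℝ) else 0) := by
    have := avg_mul_smooth I f fun x => if A ⊆ x then (1 : ℝ) else 0
    rw [← hcube] at this
    rw [← hm] at this
    rw [← this]
    congr 1
    funext x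
    by_cases hx : A ⊆ x <;> simp [hx]
  rw [h1, div_eq_mul_one_div, ← avg_superset, ← avg_const_mul]
  refine avg_mono fun x => ?_
  split_ifs with hx
  · have : m A ≤ m x := hmono' hx
    linarith
  · simp

end Structure

end BooleanCube

section Code

variable {ι : Type*} [DecidableEq ι]

/-- A binary linear code of length `G`, without zero coordinates and without repeated
coordinates, given by the supports of its words. -/
structure IsSeparatingCode (G : Finset ι) (R : Finset (Finset ι)) : Prop where
  subset : ∀ x ∈ R, x ⊆ G
  empty_mem : ∅ ∈ R
  symmDiff_mem : ∀ x ∈ R, ∀ y ∈ R, symmDiff x y ∈ R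
  exists_mem : ∀ e ∈ G, ∃ x ∈ R, e ∈ x
  separated : ∀ e ∈ G, ∀ e' ∈ G, e ≠ e' → ∃ x ∈ R, e ∈ x ∧ e' ∉ x

lemma card_symmDiff_add (x y : Finset ι) :
    (symmDiff x y).card + 2 * (x ∩ y).card = x.card + y.card := by
  have h1 := Finset.card_sdiff_add_card_inter x y
  have h2 := Finset.card_sdiff_add_card_inter y x
  have h3 : (symmDiff x y).card = (x \ y).card + (y \ x).card := by
    rw [symmDiff_def, Finset.sup_eq_union, Finset.card_union_of_disjoint]
    exact disjoint_sdiff_sdiff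
  rw [Finset.inter_comm] at h2
  omega

namespace IsSeparatingCode

variable {G : Finset ι} {R : Finset (Finset ι)} (h : IsSeparatingCode G R)
include h

lemma sum_character_eq_zero {χ : Finset ι → ℝ} (hχ : ∀ x y, χ (symmDiff x y) = χ x * χ y)
    {z : Finset ι} (hz : z ∈ R) (hχz : χ z = -1) : ∑ x ∈ R, χ x = 0 := by
  have : ∑ x ∈ R, χ x = ∑ x ∈ R, χ (symmDiff x z) := by
    refine Finset.sum_bij' (fun x _ => symmDiff x z) (fun x _ => symmDiff x z)
      (fun x hx => h.symmDiff_mem x hx z hz) (fun x hx => h.symmDiff_mem x hx z hz) ?_ ?_ ?_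
    · simp [symmDiff_symmDiff_cancel_right]
    · simp [symmDiff_symmDiff_cancel_right]
    · simp [symmDiff_symmDiff_cancel_right]
  simp only [hχ, hχz, mul_neg, mul_one, Finset.sum_neg_distrib] at this
  linarith

lemma sum_sign (e : ι) (he : e ∈ G) : ∑ x ∈ R, (if e ∈ x then (-1 : ℝ) else 1) = 0 := by
  obtain ⟨z, hz, hez⟩ := h.exists_mem e he
  refine h.sum_character_eq_zero (χ := fun x => if e ∈ x then -1 else 1) ?_ hz (by simp [hez])
  intro x y
  by_cases h1 : e ∈ x <;> by_cases h2 : e ∈ y <;> simp [Finset.mem_symmDiff, h1, h2]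

lemma sum_sign_mul_sign (e e' : ι) (he : e ∈ G) (he' : e' ∈ G) (hne : e ≠ e') :
    ∑ x ∈ R, (if e ∈ x then (-1 : ℝ) else 1) * (if e' ∈ x then (-1 : ℝ) else 1) = 0 := by
  obtain ⟨z, hz, hez, hez'⟩ := h.separated e he e' he' hne
  refine h.sum_character_eq_zero
    (χ := fun x => (if e ∈ x then -1 else 1) * (if e' ∈ x then -1 else 1)) ?_ hz
    (by simp [hez, hez'])
  intro x y
  by_cases h1 : e ∈ x <;> by_cases h2 : e ∈ y <;> by_cases h3 : e' ∈ x <;>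
    by_cases h4 : e' ∈ y <;> simp [Finset.mem_symmDiff, h1, h2, h3, h4]

lemma sum_sign_eq {x : Finset ι} (hx : x ∈ R) :
    ∑ e ∈ G, (if e ∈ x then (-1 : ℝ) else 1) = G.card - 2 * x.card := by
  have h1 : ∀ e, (if e ∈ x then (-1 : ℝ) else 1) = 1 - 2 * (if e ∈ x then 1 else 0) := by
    intro e
    split_ifs <;> norm_num
  simp only [h1, Finset.sum_sub_distrib, ← Finset.mul_sum]
  simp [Finset.inter_eq_right.mpr (h.subset x hx)]

lemma sum_centered : ∑ x ∈ R, ((G.card : ℝ) - 2 * x.card) = 0 := by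
  rw [Finset.sum_congr rfl fun x hx => (h.sum_sign_eq hx).symm, Finset.sum_comm]
  exact Finset.sum_eq_zero fun e he => h.sum_sign e he

lemma sum_centered_sq : ∑ x ∈ R, ((G.card : ℝ) - 2 * x.card) ^ 2 = (G.card : ℝ) * R.card := by
  have h1 : ∀ x ∈ R, ((G.card : ℝ) - 2 * x.card) ^ 2 = ∑ e ∈ G, ∑ e' ∈ G,
      (if e ∈ x then (-1 : ℝ) else 1) * (if e' ∈ x then (-1 : ℝ) else 1) := fun x hx => by
    rw [← h.sum_sign_eq hx, sq, Finset.sum_mul_sum]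
  rw [Finset.sum_congr rfl h1, Finset.sum_comm]
  have h2 : ∀ e ∈ G, ∑ x ∈ R, ∑ e' ∈ G,
      (if e ∈ x then (-1 : ℝ) else 1) * (if e' ∈ x then (-1 : ℝ) else 1) = R.card := by
    intro e he
    rw [Finset.sum_comm, Finset.sum_eq_single_of_mem e he]
    · have h3 : ∀ x : Finset ι,
          (if e ∈ x then (-1 : ℝ) else 1) * (if e ∈ x then (-1 : ℝ) else 1) = 1 := fun x => by
        split_ifs <;> norm_num
      simp [h3]
    · intro e' he' hne
      exact h.sum_sign_mul_sign e e' he he' hne.symm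
  rw [Finset.sum_congr rfl h2]
  simp

lemma sum_card : ∑ x ∈ R, (x.card : ℝ) = G.card * R.card / 2 := by
  have := h.sum_centered
  simp only [Finset.sum_sub_distrib, ← Finset.mul_sum, Finset.sum_const, nsmul_eq_mul] at this
  linarith

lemma sum_card_sq : ∑ x ∈ R, (x.card : ℝ) ^ 2 = R.card * (G.card ^ 2 + G.card) / 4 := by
  have h1 := h.sum_centered_sq
  have h2 : ∀ x : Finset ι, ((G.card : ℝ) - 2 * x.card) ^ 2 =
      (G.card : ℝ) ^ 2 - 4 * G.card * x.card + 4 * (x.card : ℝ) ^ 2 := fun x => by ring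
  simp only [h2, Finset.sum_sub_distrib, Finset.sum_add_distrib, ← Finset.mul_sum, h.sum_card,
    Finset.sum_const, nsmul_eq_mul] at h1
  linarith

lemma card_pos : 0 < R.card := Finset.card_pos.mpr ⟨_, h.empty_mem⟩

lemma card_coord_le_card : G.card ≤ R.card := by
  have h1 := h.sum_centered_sq
  have h2 := Finset.single_le_sum (f := fun x : Finset ι => ((G.card : ℝ) - 2 * x.card) ^ 2)
    (fun x _ => sq_nonneg _) h.empty_mem
  rw [h1] at h2
  simp only [Finset.card_empty, Nat.cast_zero, mul_zero, sub_zero, sq] at h2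
  rcases Nat.eq_zero_or_pos G.card with h0 | h0
  · omega
  · have : (0 : ℝ) < G.card := by exact_mod_cast h0
    exact_mod_cast le_of_mul_le_mul_left h2 this

lemma four_dvd_card (hG : 2 ≤ G.card) : 4 ∣ R.card := by
  obtain ⟨e, he, e', he', hne⟩ := Finset.one_lt_card.mp hG
  have h1 := h.sum_sign_mul_sign e e' he he' hne
  have h2 := h.sum_sign e he
  have h3 := h.sum_sign e' he'
  have h4 : ∀ x : Finset ι, 4 * (if e ∈ x ∧ e' ∈ x then (1 : ℝ) else 0) =
      1 - (if e ∈ x then (-1 : ℝ) else 1) - (if e' ∈ x then (-1 : ℝ) else 1)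
      + (if e ∈ x then (-1 : ℝ) else 1) * (if e' ∈ x then (-1 : ℝ) else 1) := by
    intro x
    by_cases h1 : e ∈ x <;> by_cases h2 : e' ∈ x <;> (simp [h1, h2]; try norm_num)
  have h5 : ∑ x ∈ R, 4 * (if e ∈ x ∧ e' ∈ x then (1 : ℝ) else 0) = R.card := by
    simp only [h4, Finset.sum_add_distrib, Finset.sum_sub_distrib, h1, h2, h3]
    simp
  rw [← Finset.mul_sum, Finset.sum_boole] at h5
  exact ⟨_, by exact_mod_cast h5.symm⟩

lemma sum_parity : (∑ x ∈ R, (-1 : ℝ) ^ x.card = 0) ∨ ∀ x ∈ R, Even x.card := by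
  by_cases hodd : ∃ z ∈ R, Odd z.card
  · obtain ⟨z, hz, hzo⟩ := hodd
    left
    refine h.sum_character_eq_zero (χ := fun x => (-1 : ℝ) ^ x.card) ?_ hz hzo.neg_one_pow
    intro x y
    have h1 := card_symmDiff_add x y
    have h2 : (-1 : ℝ) ^ (symmDiff x y).card * (-1) ^ (2 * (x ∩ y).card) =
        (-1) ^ x.card * (-1) ^ y.card := by
      rw [← pow_add, h1, pow_add]
    simpa [pow_mul] using h2
  · right
    intro x hx
    by_contra hx'
    exact hodd ⟨x, hx, Nat.not_even_iff_odd.mp hx'⟩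

/-- The singleton words span a full cube inside the code. -/
lemma exists_bridges : ∃ N ⊆ G, N.card = (R.filter fun x => x.card = 1).card ∧ N.powerset ⊆ R := by
  classical
  refine ⟨G.filter fun e => {e} ∈ R, Finset.filter_subset _ _, ?_, ?_⟩
  · refine Finset.card_bij (fun e _ => {e}) ?_ ?_ ?_
    · intro e he
      simp_all
    · intro e _ e' _ hee
      simpa using hee
    · intro x hx
      obtain ⟨hx, hx1⟩ := Finset.mem_filter.mp hx
      obtain ⟨e, rfl⟩ := Finset.card_eq_one.mp hx1
      exact ⟨e, by simpa [hx] using h.subset _ hx (Finset.mem_singleton_self e), rfl⟩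
  · intro x hx
    have hx := Finset.mem_powerset.mp hx
    clear * - hx h
    induction x using Finset.induction_on with
    | empty => exact h.empty_mem
    | insert e x hex ih =>
      have h1 := ih ((Finset.subset_insert e x).trans hx)
      have h2 := (Finset.mem_filter.mp (hx (Finset.mem_insert_self e x))).2
      have h3 : insert e x = symmDiff {e} x := by
        ext a
        simp only [Finset.mem_insert, Finset.mem_symmDiff, Finset.mem_singleton]
        constructor
        · rintro (rfl | ha)
          · exact Or.inl ⟨rfl, hex⟩
          · exact Or.inr ⟨ha, fun hae => hex (hae ▸ ha)⟩
        · tauto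
      rw [h3]
      exact h.symmDiff_mem _ h2 _ h1

lemma two_pow_card_singletons_le : 2 ^ (R.filter fun x => x.card = 1).card ≤ R.card := by
  obtain ⟨N, -, hN, hNR⟩ := h.exists_bridges
  rw [← hN, ← Finset.card_powerset]
  exact Finset.card_le_card hNR

lemma card_singletons_le : (R.filter fun x => x.card = 1).card ≤ G.card := by
  obtain ⟨N, hNG, hN, -⟩ := h.exists_bridges
  exact hN ▸ Finset.card_le_card hNG

lemma two_pow_succ_card_singletons_le
    (hlt : (R.filter fun x => x.card = 1).card < G.card) :
    2 ^ ((R.filter fun x => x.card = 1).card + 1) ≤ R.card := by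
  obtain ⟨N, hNG, hN, hNR⟩ := h.exists_bridges
  rw [← hN] at hlt ⊢
  obtain ⟨e, heG, heN⟩ := Finset.exists_mem_notMem_of_card_lt_card hlt
  obtain ⟨z, hz, hez⟩ := h.exists_mem e heG
  have hinj : Set.InjOn (fun x => symmDiff z x) (N.powerset : Set (Finset ι)) :=
    fun x _ y _ hxy => symmDiff_right_injective z hxy
  have hdisj : Disjoint N.powerset (N.powerset.image fun x => symmDiff z x) := by
    rw [Finset.disjoint_left]
    intro x hx hx'
    obtain ⟨y, hy, rfl⟩ := Finset.mem_image.mp hx'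
    have h1 : e ∉ y := fun he => heN (Finset.mem_powerset.mp hy he)
    exact heN (Finset.mem_powerset.mp hx (Finset.mem_symmDiff.mpr (Or.inl ⟨hez, h1⟩)))
  have hsub : N.powerset ∪ N.powerset.image (fun x => symmDiff z x) ⊆ R := by
    refine Finset.union_subset hNR fun x hx => ?_
    obtain ⟨y, hy, rfl⟩ := Finset.mem_image.mp hx
    exact h.symmDiff_mem z hz y (hNR hy)
  have := Finset.card_le_card hsub
  rw [Finset.card_union_of_disjoint hdisj, Finset.card_image_of_injOn hinj,
    Finset.card_powerset] at this
  rw [pow_succ]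
  omega

lemma sum_le_of_pointwise {f : Finset ι → ℝ} (a b c d₀ d₁ d₄ o : ℝ)
    (hf : ∀ x ∈ R, f x ≤ a + b * x.card + c * (x.card : ℝ) ^ 2 + d₀ * (if x.card = 0 then 1 else 0)
      + d₁ * (if x.card = 1 then 1 else 0) + d₄ * (if x.card = 4 then 1 else 0)
      + o * (-1) ^ x.card) :
    ∑ x ∈ R, f x ≤ a * R.card + b * (G.card * R.card / 2) +
      c * (R.card * (G.card ^ 2 + G.card) / 4) + d₀
      + d₁ * (R.filter fun x => x.card = 1).card + d₄ * (R.filter fun x => x.card = 4).card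
      + o * ∑ x ∈ R, (-1) ^ x.card := by
  refine (Finset.sum_le_sum hf).trans (le_of_eq ?_)
  have h0 : R.filter (fun x => x.card = 0) = {∅} := by
    ext x
    simp only [Finset.mem_filter, Finset.card_eq_zero, Finset.mem_singleton]
    exact ⟨fun hx => hx.2, fun hx => ⟨hx ▸ h.empty_mem, hx⟩⟩
  simp only [Finset.sum_add_distrib, ← Finset.mul_sum, Finset.sum_boole, h.sum_card,
    h.sum_card_sq, h0, Finset.sum_const, nsmul_eq_mul]
  simp only [Finset.card_singleton]
  ring

lemma sum_comp_card (g : ℕ → ℝ) :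
    ∑ x ∈ R, g x.card =
      ∑ j ∈ Finset.range (G.card + 1), (R.filter fun x => x.card = j).card * g j := by
  rw [← Finset.sum_fiberwise_of_maps_to (t := Finset.range (G.card + 1)) (g := Finset.card)]
  · refine Finset.sum_congr rfl fun j _ => ?_
    rw [Finset.sum_congr rfl fun x hx => by rw [(Finset.mem_filter.mp hx).2], Finset.sum_const,
      nsmul_eq_mul]
  · intro x hx
    have := Finset.card_le_card (h.subset x hx)
    simp only [Finset.mem_range]
    omega

end IsSeparatingCode

/-- The weight given to a cut of a graph according to its size. -/
noncomputable def cutWeight : ℕ → ℝ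
  | 0 => 28
  | 1 => -20
  | 2 => -4
  | 3 => 3
  | _ => 0

lemma cutWeight_eq_zero {m : ℕ} (hm : 4 ≤ m) : cutWeight m = 0 := by
  obtain ⟨j, rfl⟩ := Nat.exists_eq_add_of_le hm
  rw [Nat.add_comm]
  rfl

/-- A correction to `cutWeight` on the words of size four, whose sign records whether the
word is orthogonal to the whole code. -/
noncomputable def quadSign (R : Finset (Finset ι)) (x : Finset ι) : ℝ :=
  if x.card = 4 then if ∀ y ∈ R, Even (x ∩ y).card then -1 else 1 else 0

/-- `cutWeight` together with its correction. -/
noncomputable def codeWeight (R : Finset (Finset ι)) (x : Finset ι) : ℝ :=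
  cutWeight x.card + 1 / 10 * quadSign R x

lemma abs_codeWeight_sub_le (R : Finset (Finset ι)) (x : Finset ι) :
    |codeWeight R x - cutWeight x.card| ≤ 1 / 10 := by
  unfold codeWeight quadSign
  split_ifs <;> norm_num

lemma codeWeight_of_card_lt {R : Finset (Finset ι)} {x : Finset ι} (hx : x.card < 4) :
    codeWeight R x = cutWeight x.card := by
  simp [codeWeight, quadSign, hx.ne]

lemma sum_codeWeight_powerset {G : Finset ι} (hG : G.card = 4) :
    ∑ x ∈ G.powerset, codeWeight G.powerset x = -64 + 1 / 10 := by
  have h1 : ∑ x ∈ G.powerset, cutWeight x.card = -64 := by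
    rw [Finset.sum_powerset_apply_card, hG]
    simp only [Finset.sum_range_succ, Finset.sum_range_zero, cutWeight]
    norm_num [Nat.choose]
  have h2 : ∑ x ∈ G.powerset, quadSign G.powerset x = 1 := by
    rw [Finset.sum_eq_single_of_mem G (Finset.mem_powerset_self G)]
    · obtain ⟨e, he⟩ := Finset.card_pos.mp (by omega : 0 < G.card)
      rw [quadSign, if_pos hG, if_neg]
      intro hall
      have := hall {e} (by simpa using he)
      simp [he] at this
    · intro x hx hne
      have hne4 : x.card ≠ 4 := fun h4 =>
        hne (Finset.eq_of_subset_of_card_le (Finset.mem_powerset.mp hx) (by omega))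
      simp [quadSign, hne4]
  simp only [codeWeight, Finset.sum_add_distrib, ← Finset.mul_sum, h1, h2]
  norm_num

namespace IsSeparatingCode

variable {G : Finset ι} {R : Finset (Finset ι)} (h : IsSeparatingCode G R)
include h

lemma sum_codeWeight_le_of_card_eq_one (hG : G.card = 1) :
    ∑ x ∈ R, codeWeight R x ≤ 4 * R.card := by
  refine (h.sum_le_of_pointwise 28 (-48) 0 0 0 0 0 fun x hx => ?_).trans ?_
  · have hX := Finset.card_le_card (h.subset x hx)
    rw [codeWeight_of_card_lt (by omega)]
    rw [hG] at hX
    interval_cases x.card <;> norm_num [cutWeight]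
  · rw [hG]
    push_cast
    linarith

lemma le_sum_codeWeight_of_card_eq_two (hG : G.card = 2) :
    -4 * R.card ≤ ∑ x ∈ R, codeWeight R x := by
  have := h.sum_le_of_pointwise (f := fun x => -codeWeight R x) (-28) 80 (-32) 0 0 0 0
    fun x hx => by
      have hX := Finset.card_le_card (h.subset x hx)
      rw [codeWeight_of_card_lt (by omega)]
      rw [hG] at hX
      interval_cases x.card <;> norm_num [cutWeight]
  rw [hG, Finset.sum_neg_distrib] at this
  push_cast at this
  linarith

lemma sum_codeWeight_le_of_card_eq_three (hG : G.card = 3) :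
    ∑ x ∈ R, codeWeight R x ≤ 4 * R.card := by
  have hw : 4 ≤ R.card := by
    have := h.card_coord_le_card
    have := h.four_dvd_card (by omega)
    omega
  have hw' : (4 : ℝ) ≤ R.card := by exact_mod_cast hw
  refine (h.sum_le_of_pointwise (-45) (59 / 2) (-(9 / 2)) 73 0 0 0 fun x hx => ?_).trans ?_
  · have hX := Finset.card_le_card (h.subset x hx)
    rw [codeWeight_of_card_lt (by omega)]
    rw [hG] at hX
    interval_cases x.card <;> norm_num [cutWeight]
  · rw [hG]
    push_cast
    linarith

lemma sum_parity_nonneg : 0 ≤ ∑ x ∈ R, (-1 : ℝ) ^ x.card := by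
  rcases h.sum_parity with h0 | h0
  · exact h0.ge
  · exact Finset.sum_nonneg fun x hx => by rw [(h0 x hx).neg_one_pow]; norm_num

lemma le_sum_codeWeight_of_few_singletons (hG : 4 ≤ G.card)
    (h1 : (R.filter fun x => x.card = 1).card ≤ 2) :
    (-4 + 1 / 160) * R.card ≤ ∑ x ∈ R, codeWeight R x := by
  have hk : (4 : ℝ) ≤ G.card := by exact_mod_cast hG
  have hw : (0 : ℝ) < R.card := by exact_mod_cast h.card_pos
  have h1' : ((R.filter fun x => x.card = 1).card : ℝ) ≤ 2 := by exact_mod_cast h1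
  obtain ⟨t, ht0, ht⟩ : ∃ t : ℝ, 0 < t ∧ t * (G.card * (G.card - 2)) = 4 := by
    have : (0 : ℝ) < G.card * (G.card - 2) := by nlinarith
    exact ⟨4 / (G.card * (G.card - 2)), by positivity, div_mul_cancel₀ _ this.ne'⟩
  have := h.sum_le_of_pointwise (f := fun x => -codeWeight R x) (41 / 10) (2 * t) (-t) (-32) 16 0 0
    fun x hx => by
      have hX : (x.card : ℝ) ≤ G.card := by exact_mod_cast Finset.card_le_card (h.subset x hx)
      have habs := (abs_le.mp (abs_codeWeight_sub_le R x)).1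
      have hq : x.card ≠ 0 → t * (x.card * (x.card - 2)) ≤ 4 := by
        intro hx0
        have : (1 : ℝ) ≤ x.card := by exact_mod_cast Nat.one_le_iff_ne_zero.mpr hx0
        rw [← ht]
        refine mul_le_mul_of_nonneg_left ?_ ht0.le
        nlinarith [mul_nonneg (sub_nonneg.mpr hX) (by linarith : (0 : ℝ) ≤ G.card + x.card - 2)]
      rcases Nat.lt_or_ge x.card 4 with hx4 | hx4
      · interval_cases hc : x.card <;> norm_num [cutWeight] at habs hq ⊢ <;> linarith
      · rw [cutWeight_eq_zero hx4] at habs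
        have := hq (by omega)
        rw [if_neg (by omega), if_neg (by omega)]
        linarith
  rw [Finset.sum_neg_distrib] at this
  have h2 : 2 ≤ t * (G.card * (G.card - 3)) := by nlinarith
  nlinarith

lemma card_eq_of_all_singletons (h1 : (R.filter fun x => x.card = 1).card = G.card) :
    R = G.powerset := by
  obtain ⟨N, hNG, hN, hNR⟩ := h.exists_bridges
  obtain rfl := Finset.eq_of_subset_of_card_le hNG (by omega)
  exact (hNR.antisymm fun x hx => Finset.mem_powerset.mpr (h.subset x hx)).symm

lemma le_sum_codeWeight_of_many_singletons (hG : 4 ≤ G.card) (hk : Even G.card)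
    (h1 : 3 ≤ (R.filter fun x => x.card = 1).card) :
    (-4 + 1 / 160) * R.card ≤ ∑ x ∈ R, codeWeight R x := by
  have hP : ∑ x ∈ R, (-1 : ℝ) ^ x.card = 0 := by
    rcases h.sum_parity with h0 | h0
    · exact h0
    · obtain ⟨x, hx⟩ := Finset.card_pos.mp (by omega : 0 < (R.filter fun x => x.card = 1).card)
      obtain ⟨hx, hx1⟩ := Finset.mem_filter.mp hx
      have := h0 x hx
      rw [hx1] at this
      simp at this
  have hsum := h.sum_le_of_pointwise (f := fun x => -codeWeight R x)
    (21 / 10) 0 0 (-32) 20 0 2 fun x hx => by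
      have habs := (abs_le.mp (abs_codeWeight_sub_le R x)).1
      rcases Nat.lt_or_ge x.card 4 with hx4 | hx4
      · interval_cases hc : x.card <;> norm_num [cutWeight] at habs ⊢ <;> linarith
      · rw [cutWeight_eq_zero hx4] at habs
        rw [if_neg (by omega), if_neg (by omega)]
        have : -1 ≤ (-1 : ℝ) ^ x.card := by
          rcases neg_one_pow_eq_or ℝ x.card with h | h <;> rw [h] <;> norm_num
        linarith
  rw [Finset.sum_neg_distrib, hP] at hsum
  have key : 20 * ((R.filter fun x => x.card = 1).card : ℝ) - 32 ≤ 303 / 160 * R.card →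
      (-4 + 1 / 160) * R.card ≤ ∑ x ∈ R, codeWeight R x := fun hle => by linarith
  have hle := h.card_singletons_le
  rcases hle.lt_or_eq with hlt | heq
  · have hw := h.two_pow_succ_card_singletons_le hlt
    refine key ?_
    generalize (R.filter fun x => x.card = 1).card = m at *
    have hpow : ∀ m : ℕ, 3 ≤ m → 20 * (m : ℝ) - 32 ≤ 303 / 160 * 2 ^ (m + 1) := by
      intro m hm
      induction m, hm using Nat.le_induction with
      | base => norm_num
      | succ m hm ih =>
        have : (2 : ℝ) ^ 4 ≤ 2 ^ (m + 1) := pow_le_pow_right₀ (by norm_num) (by omega)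
        rw [pow_succ 2 (m + 1)]
        push_cast
        linarith
    have : (2 : ℝ) ^ (m + 1) ≤ R.card := by exact_mod_cast hw
    have := hpow m h1
    linarith
  · rcases hG.eq_or_lt with hG4 | hG5
    · obtain rfl := h.card_eq_of_all_singletons heq
      rw [sum_codeWeight_powerset hG4.symm, Finset.card_powerset, ← hG4]
      norm_num
    · refine key ?_
      have hw := h.two_pow_card_singletons_le
      rw [heq] at hw ⊢
      have hpow : ∀ m : ℕ, 6 ≤ m → 20 * (m : ℝ) - 32 ≤ 303 / 160 * 2 ^ m := by
        intro m hm
        induction m, hm using Nat.le_induction with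
        | base => norm_num
        | succ m hm ih =>
          have : (2 : ℝ) ^ 6 ≤ 2 ^ m := pow_le_pow_right₀ (by norm_num) (by omega)
          rw [pow_succ 2 m]
          push_cast
          linarith
      have : (2 : ℝ) ^ G.card ≤ R.card := by exact_mod_cast hw
      have := hpow G.card (by obtain ⟨j, hj⟩ := hk; omega)
      linarith

lemma sum_codeWeight_le_of_twelve_le (hw : 12 ≤ R.card) :
    ∑ x ∈ R, codeWeight R x ≤ (4 - 1 / 160) * R.card := by
  have hP := h.sum_parity_nonneg
  have hw' : (12 : ℝ) ≤ R.card := by exact_mod_cast hw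
  have hsum := h.sum_le_of_pointwise (f := codeWeight R) (16 / 10) 0 0 28 0 0 (-(3 / 2))
    fun x hx => by
      have habs := (abs_le.mp (abs_codeWeight_sub_le R x)).2
      rcases Nat.lt_or_ge x.card 4 with hx4 | hx4
      · interval_cases hc : x.card <;> norm_num [cutWeight] at habs ⊢ <;> linarith
      · rw [cutWeight_eq_zero hx4] at habs
        rw [if_neg (by omega)]
        have : (-1 : ℝ) ^ x.card ≤ 1 := by
          rcases neg_one_pow_eq_or ℝ x.card with h | h <;> rw [h] <;> norm_num
        linarith
  linarith

lemma sum_codeWeight_le_of_card_eq_seven (hG : G.card = 7) (hw : R.card = 8) :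
    ∑ x ∈ R, codeWeight R x ≤ (4 - 1 / 160) * R.card := by
  have hsum := h.sum_le_of_pointwise (f := codeWeight R) (1 / 10 + 31 / 10 * 16) (-(31 / 10 * 8))
    (31 / 10) (28 - 31 / 10 * 16) 0 0 0
    fun x hx => by
      have habs := (abs_le.mp (abs_codeWeight_sub_le R x)).2
      rcases Nat.lt_or_ge x.card 4 with hx4 | hx4
      · interval_cases hc : x.card <;> norm_num [cutWeight] at habs ⊢ <;> linarith
      · rw [cutWeight_eq_zero hx4] at habs
        rw [if_neg (by omega)]
        nlinarith [sq_nonneg ((x.card : ℝ) - 4)]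
  rw [hG, hw] at hsum
  rw [hw]
  push_cast at hsum ⊢
  linarith

lemma sum_codeWeight_le_of_card_eq_five (hG : G.card = 5) (hw : R.card = 8) :
    ∑ x ∈ R, codeWeight R x ≤ (4 - 1 / 160) * R.card := by
  set N : ℕ → ℕ := fun j => (R.filter fun x => x.card = j).card with hN
  have hsum : ∀ g : ℕ → ℝ, ∑ x ∈ R, g x.card =
      N 0 * g 0 + N 1 * g 1 + N 2 * g 2 + N 3 * g 3 + N 4 * g 4 + N 5 * g 5 := by
    intro g
    rw [h.sum_comp_card, hG]
    simp [Finset.sum_range_succ, hN]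
  have hN0 : N 0 = 1 := by
    rw [hN, Finset.card_eq_one]
    refine ⟨∅, ?_⟩
    ext x
    simp only [Finset.mem_filter, Finset.card_eq_zero, Finset.mem_singleton]
    exact ⟨fun hx => hx.2, fun hx => ⟨hx ▸ h.empty_mem, hx⟩⟩
  have e0 : N 0 + N 1 + N 2 + N 3 + N 4 + N 5 = 8 := by
    have := hsum fun _ => 1
    simp only [Finset.sum_const, hw, nsmul_eq_mul, mul_one] at this
    exact_mod_cast this.symm
  have e1 : N 1 + 2 * N 2 + 3 * N 3 + 4 * N 4 + 5 * N 5 = 20 := by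
    have := hsum fun j => j
    rw [h.sum_card, hG, hw] at this
    have h' : (N 1 + 2 * N 2 + 3 * N 3 + 4 * N 4 + 5 * N 5 : ℝ) = 20 := by
      push_cast at this
      linarith
    exact_mod_cast h'
  have e2 : N 1 + 4 * N 2 + 9 * N 3 + 16 * N 4 + 25 * N 5 = 60 := by
    have := hsum fun j => (j : ℝ) ^ 2
    rw [h.sum_card_sq, hG, hw] at this
    have h' : (N 1 + 4 * N 2 + 9 * N 3 + 16 * N 4 + 25 * N 5 : ℝ) = 60 := by
      push_cast at this
      linarith
    exact_mod_cast h'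
  have hbase : ∑ x ∈ R, cutWeight x.card = N 0 * 28 + N 1 * -20 + N 2 * -4 + N 3 * 3 := by
    rw [hsum]
    simp [cutWeight]
  have hdecomp : ∑ x ∈ R, codeWeight R x =
      ∑ x ∈ R, cutWeight x.card + 1 / 10 * ∑ x ∈ R, quadSign R x := by
    simp only [codeWeight, Finset.sum_add_distrib, Finset.mul_sum]
  have hquad : ∑ x ∈ R, quadSign R x =
      ∑ x ∈ R.filter fun x => x.card = 4, if ∀ y ∈ R, Even (x ∩ y).card then -1 else 1 := by
    rw [Finset.sum_filter]
    rfl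
  have hcases : N 1 + N 4 = 1 ∧ N 5 = 0 := by omega
  obtain ⟨h14, h5⟩ := hcases
  rw [hdecomp, hbase, hw]
  rcases Nat.eq_zero_or_pos (N 4) with h4 | h4
  · rw [hquad, Finset.card_eq_zero.mp h4, Finset.sum_empty, hN0]
    have h1 : N 1 = 1 := by omega
    have h3 : (N 3 : ℝ) ≤ 6 := by exact_mod_cast (by omega : N 3 ≤ 6)
    rw [h1]
    have : (0 : ℝ) ≤ N 2 := by positivity
    push_cast
    linarith
  · have h4 : N 4 = 1 := by omega
    have h1 : N 1 = 0 := by omega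
    have h2 : N 2 = 2 := by omega
    have h3 : N 3 = 4 := by omega
    obtain ⟨c, hc⟩ := Finset.card_eq_one.mp h4
    have hcR : c ∈ R ∧ c.card = 4 := Finset.mem_filter.mp (hc ▸ Finset.mem_singleton_self c)
    have hrange : ∀ x ∈ R, x ≠ ∅ → x ≠ c → x.card = 2 ∨ x.card = 3 := by
      intro x hx hx0 hxc
      have hle := Finset.card_le_card (h.subset x hx)
      have hpos := Finset.card_pos.mpr (Finset.nonempty_iff_ne_empty.mpr hx0)
      have n1 : x.card ≠ 1 := fun hx1 =>
        Finset.eq_empty_iff_forall_notMem.mp (Finset.card_eq_zero.mp h1) x (by simp [hx, hx1])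
      have n4 : x.card ≠ 4 := fun hx4 =>
        hxc (Finset.mem_singleton.mp (hc ▸ Finset.mem_filter.mpr ⟨hx, hx4⟩))
      have n5 : x.card ≠ 5 := fun hx5 =>
        Finset.eq_empty_iff_forall_notMem.mp (Finset.card_eq_zero.mp h5) x (by simp [hx, hx5])
      omega
    have horth : ∀ y ∈ R, Even (c ∩ y).card := by
      intro y hy
      by_cases hy0 : y = ∅
      · simp [hy0]
      by_cases hyc : y = c
      · rw [hyc, Finset.inter_self, hcR.2]
        decide
      have r1 := hrange y hy hy0 hyc
      have r2 := hrange (symmDiff c y) (h.symmDiff_mem c hcR.1 y hy)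
        (fun he => hyc (symmDiff_eq_bot.mp he).symm)
        (fun he => hy0 (symmDiff_eq_left.mp he))
      have := card_symmDiff_add c y
      exact ⟨1, by omega⟩
    rw [hquad, hc, Finset.sum_singleton, if_pos horth, hN0, h1, h2, h3]
    norm_num

/-- On a code with at least four coordinates, the sign-alternating weight exceeds `-4` times
the size of the code by a fixed proportion. -/
lemma gap_mul_le_sum_codeWeight (hG : 4 ≤ G.card) :
    (-4 + 1 / 160) * R.card ≤ (-1) ^ G.card * ∑ x ∈ R, codeWeight R x := by
  rcases Nat.even_or_odd G.card with hk | hk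
  · rw [hk.neg_one_pow, one_mul]
    rcases Nat.lt_or_ge 2 (R.filter fun x => x.card = 1).card with h1 | h1
    · exact h.le_sum_codeWeight_of_many_singletons hG hk h1
    · exact h.le_sum_codeWeight_of_few_singletons hG h1
  · rw [hk.neg_one_pow]
    suffices ∑ x ∈ R, codeWeight R x ≤ (4 - 1 / 160) * R.card by linarith
    rcases Nat.lt_or_ge R.card 12 with hw | hw
    · have h1 := h.card_coord_le_card
      have h2 := h.four_dvd_card (by omega)
      obtain ⟨j, hj⟩ := hk
      rcases (by omega : G.card = 5 ∨ G.card = 7) with h5 | h7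
      · exact h.sum_codeWeight_le_of_card_eq_five h5 (by omega)
      · exact h.sum_codeWeight_le_of_card_eq_seven h7 (by omega)
    · exact h.sum_codeWeight_le_of_twelve_le hw

/-- The sign-alternating weight of a code is at least `-4` times its size. -/
lemma neg_four_mul_le_sum_codeWeight (hG : G.Nonempty) :
    -4 * R.card ≤ (-1) ^ G.card * ∑ x ∈ R, codeWeight R x := by
  have hpos := Finset.card_pos.mpr hG
  rcases Nat.lt_or_ge G.card 4 with hlt | hge
  · rcases (by omega : G.card = 1 ∨ G.card = 2 ∨ G.card = 3) with h1 | h2 | h3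
    · have := h.sum_codeWeight_le_of_card_eq_one h1
      rw [h1]
      linarith
    · have := h.le_sum_codeWeight_of_card_eq_two h2
      rw [h2]
      linarith
    · have := h.sum_codeWeight_le_of_card_eq_three h3
      rw [h3]
      linarith
  · have := h.gap_mul_le_sum_codeWeight hge
    have hw : (0 : ℝ) ≤ R.card := by positivity
    linarith

end IsSeparatingCode

end Code

namespace BooleanCube

variable {α : Type*} [Fintype α] [DecidableEq α]

/-- If no two points of the support of `f` meet inside `C`, then the squared Fourier
coefficients of `f` annihilate every function of `S ∩ C`, up to the sign of `S`. -/
lemma sum_coeff_sq_mul_inter_eq_zero {f : Finset α → ℝ} {C : Finset α}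
    (hf : ∀ x y, x ∩ y ⊆ C → f x * f y = 0) (φ : Finset α → ℝ) :
    ∑ S, coeff f S ^ 2 * ((-1) ^ S.card * φ (S ∩ C)) = 0 := by
  have h1 : ∀ B ⊆ C, ∑ S, coeff f S ^ 2 * ((-1) ^ S.card * walsh B S) = 0 := by
    intro B hB
    have h2 := avg_mul_translate f (symmDiff Finset.univ B)
    have h3 : ∀ x, f x * f (symmDiff x (symmDiff Finset.univ B)) = 0 := by
      refine fun x => hf _ _ fun i hi => hB ?_
      simp only [Finset.mem_inter, Finset.mem_symmDiff, Finset.mem_univ, true_and] at hi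
      tauto
    simp only [h3, avg_const, walsh_symmDiff_right] at h2
    rw [h2]
    refine Finset.sum_congr rfl fun S _ => ?_
    rw [walsh_comm S, walsh_univ, walsh_comm S]
  have h4 : ∀ S, φ (S ∩ C) = ∑ B, coeff (fun S => φ (S ∩ C)) B * walsh B S := fun S =>
    (sum_coeff_mul_walsh (fun S => φ (S ∩ C)) S).symm
  have h5 : ∀ S, coeff f S ^ 2 * ((-1) ^ S.card * φ (S ∩ C)) =
      ∑ B, coeff (fun S => φ (S ∩ C)) B * (coeff f S ^ 2 * ((-1) ^ S.card * walsh B S)) := by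
    intro S
    rw [h4, Finset.mul_sum, Finset.mul_sum]
    exact Finset.sum_congr rfl fun B _ => by ring
  simp only [h5]
  rw [Finset.sum_comm]
  refine Finset.sum_eq_zero fun B _ => ?_
  rw [← Finset.mul_sum]
  by_cases hB : B ⊆ C
  · rw [h1 B hB, mul_zero]
  · obtain ⟨i, hiB, hiC⟩ := Finset.not_subset.mp hB
    rw [coeff_eq_zero_of_invariant (i := i) _ hiB, zero_mul]
    intro x
    congr 1
    ext j
    by_cases hj : j = i
    · simp [hj, hiC]
    · simp [Finset.mem_symmDiff, hj]

end BooleanCube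

section Cuts

variable {n : ℕ}

/-- The edges of the complete graph crossing the bipartition given by `y`. -/
def cut (y : Finset (Fin n)) : Finset (Sym2 (Fin n)) :=
  Finset.univ.filter fun e => ∃ a b, e = s(a, b) ∧ a ∈ y ∧ b ∉ y

lemma mk_mem_cut {y : Finset (Fin n)} {a b : Fin n} : s(a, b) ∈ cut y ↔ ¬(a ∈ y ↔ b ∈ y) := by
  simp only [cut, Finset.mem_filter, Finset.mem_univ, true_and]
  constructor
  · rintro ⟨c, d, hcd, hc, hd⟩
    rcases Sym2.eq_iff.mp hcd with ⟨rfl, rfl⟩ | ⟨rfl, rfl⟩ <;> tauto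
  · intro h
    by_cases ha : a ∈ y
    · exact ⟨a, b, rfl, ha, by tauto⟩
    · exact ⟨b, a, Sym2.eq_swap, by tauto, ha⟩

lemma cut_empty : cut (∅ : Finset (Fin n)) = ∅ := by simp [cut]

lemma cut_symmDiff (y z : Finset (Fin n)) : cut (symmDiff y z) = symmDiff (cut y) (cut z) := by
  ext e
  induction e using Sym2.ind with
  | _ a b =>
    simp only [mk_mem_cut, Finset.mem_symmDiff]
    tauto

lemma not_hasOddCycle_of_subset_cut {G : Finset (Sym2 (Fin n))} {y : Finset (Fin n)}
    (h : G ⊆ cut y) : ¬HasOddCycle G := by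
  rintro ⟨v, w, -, hodd⟩
  let c : (graphOf G).Coloring Bool := SimpleGraph.Coloring.mk (fun v => decide (v ∈ y)) (by
    intro a b hab
    have : s(a, b) ∈ G := by
      simpa [graphOf] using ((SimpleGraph.fromEdgeSet_adj _).mp hab).1
    have := mk_mem_cut.mp (h this)
    simpa [decide_eq_decide] using this)
  have := (c.odd_length_iff_not_congr w).mp hodd
  tauto

lemma HasOddCycle.mono {G H : Finset (Sym2 (Fin n))} (hGH : G ⊆ H) (h : HasOddCycle G) :
    HasOddCycle H := by
  obtain ⟨v, w, hw, hodd⟩ := h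
  have hle : graphOf G ≤ graphOf H := SimpleGraph.fromEdgeSet_mono (by exact_mod_cast hGH)
  exact ⟨v, w.mapLe hle, hw.mapLe hle, by simpa using hodd⟩

/-- A graph with at most three edges containing an odd cycle is a triangle. -/
lemma HasOddCycle.isTriangle {G : Finset (Sym2 (Fin n))} (h : HasOddCycle G) (hG : G.card ≤ 3) :
    IsTriangle G := by
  obtain ⟨v, w, hw, hodd⟩ := h
  have h3 := hw.three_le_length
  have hsub : w.edges.toFinset ⊆ G := by
    intro e he
    have := w.edges_subset_edgeSet (List.mem_toFinset.mp he)
    rw [graphOf, SimpleGraph.edgeSet_fromEdgeSet] at this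
    exact_mod_cast this.1
  have hcard : w.edges.toFinset.card = w.length := by
    rw [List.toFinset_card_of_nodup hw.edges_nodup, SimpleGraph.Walk.length_edges]
  have hle := Finset.card_le_card hsub
  have hlen : w.length = 3 := by omega
  have heq := Finset.eq_of_subset_of_card_le hsub (by omega)
  match w, hlen with
  | .cons (v := a) h1 (.cons (v := b) h2 (.cons h3 .nil)), _ =>
    refine ⟨v, a, b, h1.ne, h3.ne', h2.ne, ?_⟩
    rw [← heq]
    ext e
    simp [Sym2.eq_swap (a := b) (b := v)]
    tauto

/-- The traces on `S` of the cuts of the complete graph. -/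
lemma isSeparatingCode_image_cut {S : Finset (Sym2 (Fin n))} (hS : ∀ e ∈ S, ¬e.IsDiag) :
    IsSeparatingCode S (Finset.univ.image fun y => S ∩ cut y) where
  subset := by simp
  empty_mem := Finset.mem_image.mpr ⟨∅, Finset.mem_univ _, by simp [cut_empty]⟩
  symmDiff_mem := by
    simp only [Finset.mem_image, Finset.mem_univ, true_and]
    rintro _ ⟨y, rfl⟩ _ ⟨z, rfl⟩
    refine ⟨symmDiff y z, ?_⟩
    rw [cut_symmDiff]
    ext e
    simp only [Finset.mem_inter, Finset.mem_symmDiff]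
    tauto
  exists_mem := by
    intro e he
    induction e using Sym2.ind with
    | _ a b =>
      have hab : a ≠ b := by simpa using hS _ he
      refine ⟨_, Finset.mem_image_of_mem _ (Finset.mem_univ {a}), ?_⟩
      simp [mk_mem_cut, he, hab.symm]
  separated := by
    intro e he e' he' hne
    induction e using Sym2.ind with
    | _ a b =>
      induction e' using Sym2.ind with
      | _ c d =>
        have h1 : a ≠ b := by simpa using hS _ he
        have h2 : c ≠ d := by simpa using hS _ he'
        by_cases hac : a = c ∨ a = d
        · refine ⟨_, Finset.mem_image_of_mem _ (Finset.mem_univ {b}), ?_⟩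
          rw [Ne, Sym2.eq_iff] at hne
          simp only [Finset.mem_inter, mk_mem_cut, Finset.mem_singleton, he, he', true_and]
          grind
        · refine ⟨_, Finset.mem_image_of_mem _ (Finset.mem_univ {a}), ?_⟩
          simp only [Finset.mem_inter, mk_mem_cut, Finset.mem_singleton, he, he', true_and]
          grind

/-- All traces on `S` of cuts arise equally often. -/
lemma exists_sum_cut_eq (S : Finset (Sym2 (Fin n))) : ∃ K : ℝ, 0 < K ∧
    ∀ ψ : Finset (Sym2 (Fin n)) → ℝ, ∑ y, ψ (S ∩ cut y) =
      K * ∑ x ∈ Finset.univ.image fun y => S ∩ cut y, ψ x := by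
  refine ⟨(Finset.univ.filter fun y : Finset (Fin n) => S ∩ cut y = ∅).card, ?_, ?_⟩
  · exact_mod_cast Finset.card_pos.mpr ⟨∅, by simp [cut_empty]⟩
  · intro ψ
    rw [Finset.sum_comp ψ (fun y => S ∩ cut y), Finset.mul_sum]
    refine Finset.sum_congr rfl fun x hx => ?_
    obtain ⟨z, -, rfl⟩ := Finset.mem_image.mp hx
    rw [nsmul_eq_mul]
    congr 2
    have hcut : ∀ y, S ∩ cut (symmDiff y z) = symmDiff (S ∩ cut y) (S ∩ cut z) := by
      intro y
      rw [cut_symmDiff]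
      ext e
      simp only [Finset.mem_inter, Finset.mem_symmDiff]
      tauto
    refine Finset.card_bij' (fun y _ => symmDiff y z) (fun y _ => symmDiff y z) ?_ ?_ ?_ ?_
    · intro y hy
      simp only [Finset.mem_filter, Finset.mem_univ, true_and] at hy ⊢
      rw [hcut, hy]
      exact symmDiff_self _
    · intro y hy
      simp only [Finset.mem_filter, Finset.mem_univ, true_and] at hy ⊢
      rw [hcut, hy]
      exact bot_symmDiff _
    · simp
    · simp

/-- The sign-alternating total weight of the traces of cuts on `S`. -/
lemma sum_cut_codeWeight_bounds {S : Finset (Sym2 (Fin n))} (hS : ∀ e ∈ S, ¬e.IsDiag) :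
    ((if S = ∅ then 32 else 0) - 4 + (if S.card ≤ 3 then 0 else 1 / 160)) * (2 : ℝ) ^ n ≤
      (-1) ^ S.card * ∑ y, codeWeight (Finset.univ.image cut) (S ∩ cut y) := by
  have hcode := isSeparatingCode_image_cut hS
  obtain ⟨K, hK, hsum⟩ := exists_sum_cut_eq S
  have hw : (2 : ℝ) ^ n = K * (Finset.univ.image fun y => S ∩ cut y).card := by
    have := hsum fun _ => 1
    simpa using this
  have hψ : ∀ x ∈ Finset.univ.image fun y => S ∩ cut y,
      codeWeight (Finset.univ.image cut) x =
        codeWeight (Finset.univ.image fun y => S ∩ cut y) x := by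
    intro x hx
    have hxS := hcode.subset x hx
    have : ∀ y, x ∩ (S ∩ y) = x ∩ y := fun y => by
      rw [← Finset.inter_assoc, Finset.inter_eq_left.mpr hxS]
    simp [codeWeight, quadSign, this]
  rw [hsum, Finset.sum_congr rfl hψ, hw, mul_left_comm, mul_left_comm _ K]
  refine mul_le_mul_of_nonneg_left ?_ hK.le
  by_cases h0 : S = ∅
  · subst h0
    simp only [Finset.empty_inter, Finset.image_const Finset.univ_nonempty]
    norm_num [codeWeight, cutWeight, quadSign]
  · by_cases h3 : S.card ≤ 3
    · have := hcode.neg_four_mul_le_sum_codeWeight (Finset.nonempty_iff_ne_empty.mpr h0)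
      simpa [h0, h3] using this
    · have := hcode.gap_mul_le_sum_codeWeight (by omega)
      simpa [h0, h3] using this

end Cuts

open BooleanCube in
/-- The spectral form of the theorem on odd-cycle-intersecting families. -/
theorem tail_le_of_odd_cycle_intersecting {n : ℕ} {f : Finset (Sym2 (Fin n)) → ℝ}
    (hf : ∀ x, f x = 0 ∨ f x = 1) (hloop : ∀ e : Sym2 (Fin n), e.IsDiag →
      ∀ x, f (symmDiff x {e}) = f x)
    (hodd : ∀ x y, f x = 1 → f y = 1 → HasOddCycle (x ∩ y)) :
    1 / 160 * tail f ≤ 4 * avg f - 32 * avg f ^ 2 := by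
  have h1 : ∀ y, ∑ S, coeff f S ^ 2 *
      ((-1) ^ S.card * codeWeight (Finset.univ.image cut) (S ∩ cut y)) = 0 := by
    refine fun y => sum_coeff_sq_mul_inter_eq_zero (fun x z hxz => ?_) _
    rcases hf x with h | h
    · simp [h]
    rcases hf z with h' | h'
    · simp [h']
    exact absurd (hodd x z h h') (not_hasOddCycle_of_subset_cut hxz)
  have h2 : ∑ S, coeff f S ^ 2 *
      ((-1) ^ S.card * ∑ y, codeWeight (Finset.univ.image cut) (S ∩ cut y)) = 0 := by
    simp only [Finset.mul_sum]
    rw [Finset.sum_comm]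
    exact Finset.sum_eq_zero fun y _ => h1 y
  have h3 : ∑ S, coeff f S ^ 2 *
      (((if S = ∅ then 32 else 0) - 4 + (if S.card ≤ 3 then 0 else 1 / 160)) * (2 : ℝ) ^ n) ≤ 0 := by
    refine (Finset.sum_le_sum fun S _ => ?_).trans h2.le
    by_cases hS : ∀ e ∈ S, ¬e.IsDiag
    · exact mul_le_mul_of_nonneg_left (sum_cut_codeWeight_bounds hS) (sq_nonneg _)
    · push Not at hS
      obtain ⟨e, he, hd⟩ := hS
      simp [coeff_eq_zero_of_invariant (hloop e hd) he]
  have h4 : ∀ S, coeff f S ^ 2 *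
      (((if S = ∅ then 32 else 0) - 4 + (if S.card ≤ 3 then 0 else 1 / 160)) * (2 : ℝ) ^ n) =
      (32 * (if S = ∅ then coeff f S ^ 2 else 0) - 4 * coeff f S ^ 2 +
        1 / 160 * (if S.card ≤ 3 then 0 else coeff f S ^ 2)) * (2 : ℝ) ^ n := by
    intro S
    split_ifs <;> ring
  have h5 : avg f = ∑ S, coeff f S ^ 2 := by
    rw [← avg_sq_eq_sum_coeff_sq]
    congr 1
    funext x
    rcases hf x with h | h <;> simp [h]
  simp only [h4] at h3
  rw [← Finset.sum_mul, Finset.sum_add_distrib, Finset.sum_sub_distrib, ← Finset.mul_sum,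
    ← Finset.mul_sum, ← Finset.mul_sum, ← h5, Finset.sum_ite_eq' ] at h3
  simp only [Finset.mem_univ, if_true, coeff_empty] at h3
  have h6 := nonpos_of_mul_nonpos_left h3 (by positivity)
  unfold tail
  linarith

namespace BooleanCube

section Biased

variable {α : Type*}

/-- The expectation of `f` at a random subset of `U` containing each element with
probability `q`. -/
noncomputable def biased (U : Finset α) (q : ℝ) (f : Finset α → ℝ) : ℝ :=
  ∑ x ∈ U.powerset, q ^ x.card * (1 - q) ^ (U.card - x.card) * f x

lemma biased_mono {U : Finset α} {q : ℝ} (h0 : 0 ≤ q) (h1 : q ≤ 1) {f g : Finset α → ℝ}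
    (h : ∀ x ⊆ U, f x ≤ g x) : biased U q f ≤ biased U q g := by
  refine Finset.sum_le_sum fun x hx => mul_le_mul_of_nonneg_left (h x (Finset.mem_powerset.mp hx)) ?_
  have : 0 ≤ 1 - q := by linarith
  positivity

lemma biased_nonneg {U : Finset α} {q : ℝ} (h0 : 0 ≤ q) (h1 : q ≤ 1) {f : Finset α → ℝ}
    (h : ∀ x, 0 ≤ f x) : 0 ≤ biased U q f := by
  refine Finset.sum_nonneg fun x _ => mul_nonneg ?_ (h x)
  have : 0 ≤ 1 - q := by linarith
  positivity

lemma biased_one (U : Finset α) (q : ℝ) : biased U q (fun _ => 1) = 1 := by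
  simp [biased, Finset.sum_pow_mul_eq_add_pow]

lemma biased_sum {κ : Type*} (s : Finset κ) (U : Finset α) (q : ℝ) (f : κ → Finset α → ℝ) :
    biased U q (fun x => ∑ k ∈ s, f k x) = ∑ k ∈ s, biased U q (f k) := by
  simp only [biased, Finset.mul_sum]
  exact Finset.sum_comm

lemma biased_univ_half [Fintype α] (f : Finset α → ℝ) :
    biased Finset.univ (1 / 2) f = avg f := by
  rw [biased, avg, Finset.powerset_univ, Finset.sum_div]
  refine Finset.sum_congr rfl fun x _ => ?_
  rw [show (1 : ℝ) - 1 / 2 = 1 / 2 by norm_num, ← pow_add,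
    Nat.add_sub_cancel' (Finset.card_le_card (Finset.subset_univ x)), Finset.card_univ]
  simp [div_eq_inv_mul]

variable [DecidableEq α]

lemma biased_insert {e : α} {U : Finset α} (he : e ∉ U) (q : ℝ) (f : Finset α → ℝ) :
    biased (insert e U) q f =
      (1 - q) * biased U q f + q * biased U q fun x => f (insert e x) := by
  unfold biased
  rw [Finset.sum_powerset_insert he, Finset.mul_sum, Finset.mul_sum,
    Finset.card_insert_of_notMem he]
  congr 1
  · refine Finset.sum_congr rfl fun x hx => ?_
    have := Finset.card_le_card (Finset.mem_powerset.mp hx)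
    rw [Nat.succ_sub this, pow_succ]
    ring
  · refine Finset.sum_congr rfl fun x hx => ?_
    have hex : e ∉ x := fun h => he (Finset.mem_powerset.mp hx h)
    rw [Finset.card_insert_of_notMem hex, Nat.add_sub_add_right, pow_succ]
    ring

lemma biased_union_of_invariant (U D : Finset α) (q : ℝ) {f : Finset α → ℝ}
    (h : ∀ e ∈ D, ∀ x, f (insert e x) = f x) : biased (U ∪ D) q f = biased U q f := by
  induction D using Finset.induction_on with
  | empty => simp
  | insert e D _ ih =>
    have ih := ih fun a ha => h a (Finset.mem_insert_of_mem ha)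
    rw [Finset.union_insert]
    by_cases heU : e ∈ U ∪ D
    · rw [Finset.insert_eq_of_mem heU, ih]
    · rw [biased_insert heU]
      simp only [h e (Finset.mem_insert_self e D)]
      rw [ih]
      ring

lemma _root_.ConvexOn.add_le_add_of_add_eq_add {s : Set ℝ} {φ : ℝ → ℝ} (hφ : ConvexOn ℝ s φ)
    {a b u v : ℝ} (ha : a ∈ s) (hb : b ∈ s) (hau : a ≤ u) (hub : u ≤ b) (h : u + v = a + b) :
    φ u + φ v ≤ φ a + φ b := by
  rcases (hau.trans hub).eq_or_lt with hab | hab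
  · have h1 : u = a := by linarith
    have h2 : v = b := by linarith
    rw [h1, h2]
  · have hba : 0 < b - a := sub_pos.mpr hab
    have h1 : 0 ≤ (b - u) / (b - a) := div_nonneg (by linarith) hba.le
    have h2 : 0 ≤ (u - a) / (b - a) := div_nonneg (by linarith) hba.le
    have h3 : (b - u) / (b - a) + (u - a) / (b - a) = 1 := by
      field_simp
      ring
    have e1 := hφ.2 ha hb h1 h2 h3
    have e2 := hφ.2 hb ha h1 h2 h3
    have hu : ((b - u) / (b - a)) • a + ((u - a) / (b - a)) • b = u := by
      simp only [smul_eq_mul]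
      field_simp
      ring
    have hv : ((b - u) / (b - a)) • b + ((u - a) / (b - a)) • a = v := by
      simp only [smul_eq_mul]
      rw [eq_sub_of_add_eq' h]
      field_simp
      ring
    rw [hu] at e1
    rw [hv] at e2
    simp only [smul_eq_mul] at e1 e2
    calc φ u + φ v ≤ ((b - u) / (b - a) + (u - a) / (b - a)) * (φ a + φ b) := by linarith
      _ = φ a + φ b := by rw [h3, one_mul]

lemma rpow_two_point {q s a b : ℝ} (h0 : 0 ≤ q) (h1 : q ≤ 1) (hs : 1 ≤ s) (ha : 0 ≤ a)
    (hab : a ≤ b) :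
    (1 - q ^ s) * a ^ s + q ^ s * b ^ s ≤ ((1 - q) * a + q * b) ^ s := by
  have hb := ha.trans hab
  have h2 := (convexOn_rpow hs).add_le_add_of_add_eq_add (a := q * a)
    (b := (1 - q) * a + q * b) (u := a) (v := q * b)
    (Set.mem_Ici.mpr (by positivity))
    (Set.mem_Ici.mpr (by have : 0 ≤ 1 - q := by linarith
                         positivity)) (by nlinarith) (by nlinarith) (by ring)
  rw [Real.mul_rpow h0 ha, Real.mul_rpow h0 hb] at h2
  linarith

/-- The `p`-biased measure of an increasing function is controlled by its `q`-biased measure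
for `q ≥ p`. -/
theorem biased_rpow_le {q s : ℝ} (h0 : 0 ≤ q) (h1 : q ≤ 1) (hs : 1 ≤ s) (U : Finset α)
    {f : Finset α → ℝ} (hf : ∀ x, 0 ≤ f x) (hmono : Monotone f) :
    biased U (q ^ s) (fun x => f x ^ s) ≤ biased U q f ^ s := by
  induction U using Finset.induction_on generalizing f with
  | empty => simp [biased]
  | insert e U he ih =>
    have hmono' : Monotone fun x => f (insert e x) :=
      fun x y hxy => hmono (Finset.insert_subset_insert e hxy)
    have i1 := ih hf hmono
    have i2 := ih (f := fun x => f (insert e x)) (fun x => hf _) hmono'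
    have hle : biased U q f ≤ biased U q fun x => f (insert e x) :=
      biased_mono h0 h1 fun x _ => hmono (Finset.subset_insert e x)
    have hq1 : q ^ s ≤ 1 := Real.rpow_le_one h0 h1 (by linarith)
    have hq0 : 0 ≤ q ^ s := Real.rpow_nonneg h0 s
    rw [biased_insert he, biased_insert he]
    refine le_trans ?_ (rpow_two_point h0 h1 hs (biased_nonneg h0 h1 hf) hle)
    have := mul_le_mul_of_nonneg_left i1 (by linarith : 0 ≤ 1 - q ^ s)
    have := mul_le_mul_of_nonneg_left i2 hq0
    linarith

lemma biased_le_avg_rpow [Fintype α] {s : ℝ} (hs : 1 ≤ s) (U : Finset α)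
    {f : Finset α → ℝ} (hf : ∀ x, f x = 0 ∨ f x = 1) (hmono : Monotone f)
    (hinv : ∀ e ∉ U, ∀ x, f (insert e x) = f x) :
    biased U ((1 / 2) ^ s) f ≤ avg f ^ s := by
  have h1 : biased Finset.univ (1 / 2) f = biased U (1 / 2) f := by
    rw [← biased_union_of_invariant U Uᶜ (1 / 2) fun e he => hinv e (Finset.mem_compl.mp he),
      Finset.union_compl]
  have h2 : (fun x => f x ^ s) = f := by
    funext x
    rcases hf x with h | h
    · rw [h, Real.zero_rpow (by linarith)]
    · rw [h, Real.one_rpow]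
  have h3 := biased_rpow_le (q := 1 / 2) (by norm_num) (by norm_num) hs U
    (fun x => by rcases hf x with h | h <;> rw [h]; norm_num) hmono
  rwa [h2, ← h1, biased_univ_half] at h3

lemma avg_erase [Fintype α] (f : Finset α → ℝ) (e : α) :
    avg (fun x => f (x.erase e)) = 2 * avg fun x => if e ∈ x then 0 else f x := by
  have h1 := avg_translate {e} fun x => if e ∈ x then 0 else f x
  have h2 : ∀ x, f (x.erase e) = (if e ∈ x then 0 else f x) +
      (if e ∈ symmDiff x {e} then 0 else f (symmDiff x {e})) := by
    intro x
    by_cases he : e ∈ x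
    · have : symmDiff x {e} = x.erase e := by
        ext a
        by_cases ha : a = e <;> simp [Finset.mem_symmDiff, ha, he]
      simp [this, he]
    · simp [he, Finset.mem_symmDiff]
  simp only [h2]
  rw [avg_add, h1]
  ring

end Biased

end BooleanCube

section Triangle

variable {n : ℕ}

lemma IsTriangle.card_eq {T : Finset (Sym2 (Fin n))} (hT : IsTriangle T) : T.card = 3 := by
  obtain ⟨a, b, c, hab, hac, hbc, rfl⟩ := hT
  rw [Finset.card_eq_three]
  refine ⟨_, _, _, ?_, ?_, ?_, rfl⟩ <;> grind

lemma IsTriangle.not_isDiag {T : Finset (Sym2 (Fin n))} (hT : IsTriangle T) :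
    ∀ e ∈ T, ¬e.IsDiag := by
  obtain ⟨a, b, c, hab, hac, hbc, rfl⟩ := hT
  simp [hab, hac, hbc]

lemma exists_isTriangle (hn : 3 ≤ n) : ∃ T : Finset (Sym2 (Fin n)), IsTriangle T :=
  ⟨_, ⟨0, by omega⟩, ⟨1, by omega⟩, ⟨2, by omega⟩, by simp, by simp, by simp, rfl⟩

lemma card_edgeFinset (n : ℕ) : (edgeFinset n).card = n.choose 2 := by
  have := Sym2.card_subtype_not_diag (α := Fin n)
  rw [Fintype.card_subtype, Fintype.card_fin] at this
  exact this

open BooleanCube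

/-- The uniform-measure form of the stability theorem. -/
theorem exists_triangle_of_odd_cycle_intersecting : ∃ θ₀ : ℝ, 0 < θ₀ ∧ ∃ C : ℝ, 0 < C ∧
    ∀ (n : ℕ) (f : Finset (Sym2 (Fin n)) → ℝ), (∀ x, f x = 0 ∨ f x = 1) → Monotone f →
      (∀ e : Sym2 (Fin n), e.IsDiag → ∀ x, f (symmDiff x {e}) = f x) →
      (∀ x y, f x = 1 → f y = 1 → HasOddCycle (x ∩ y)) →
      avg f ≤ 1 / 8 ∧ (1 / 8 - avg f ≤ θ₀ → ∃ T, IsTriangle T ∧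
        avg (fun x => if T ⊆ x then 0 else f x) ≤ C * (1 / 8 - avg f)) := by
  obtain ⟨η, hη, C, hC, hmain⟩ := exists_subcube_of_small_tail
  refine ⟨min (1 / 16) (η / 640), by positivity, 80 * C, by positivity, ?_⟩
  intro n f hf hmono hloop hodd
  have htail := tail_le_of_odd_cycle_intersecting hf hloop hodd
  have htail0 := tail_nonneg f
  have havg0 : 0 ≤ avg f := avg_nonneg fun x => by rcases hf x with h | h <;> rw [h]; norm_num
  have havg8 : avg f ≤ 1 / 8 := by
    by_contra hlt
    push Not at hlt
    nlinarith
  refine ⟨havg8, fun hθ => ?_⟩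
  have hθ1 := hθ.trans (min_le_left _ _)
  have hθ2 := hθ.trans (min_le_right _ _)
  have htailθ : tail f ≤ 640 * (1 / 8 - avg f) := by nlinarith
  obtain ⟨A, hA3, ⟨x, y, hx, hy, rfl⟩, hA⟩ :=
    hmain (Sym2 (Fin n)) f hf hmono (by linarith) (by linarith)
  have hT := (hodd x y hx hy).isTriangle hA3
  refine ⟨_, hT, ?_⟩
  rw [hT.card_eq] at hA
  have hsplit : avg f = avg (fun z => if x ∩ y ⊆ z then f z else 0) +
      avg (fun z => if x ∩ y ⊆ z then 0 else f z) := by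
    rw [← avg_add]
    congr 1
    funext z
    split_ifs <;> simp
  nlinarith

end Triangle

section Assembly

variable {n : ℕ}

open BooleanCube

open Classical in
/-- The indicator of the up-closure of a family of graphs. -/
noncomputable def upIndicator (F : Finset (Finset (Sym2 (Fin n)))) (x : Finset (Sym2 (Fin n))) :
    ℝ :=
  if ∃ G ∈ F, G ⊆ x then 1 else 0

lemma upIndicator_eq_zero_or_one (F : Finset (Finset (Sym2 (Fin n)))) (x) :
    upIndicator F x = 0 ∨ upIndicator F x = 1 := by
  unfold upIndicator
  split_ifs <;> simp

lemma upIndicator_eq_one_iff {F : Finset (Finset (Sym2 (Fin n)))} {x} :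
    upIndicator F x = 1 ↔ ∃ G ∈ F, G ⊆ x := by
  unfold upIndicator
  split_ifs with h <;> simp [h]

lemma upIndicator_of_mem {F : Finset (Finset (Sym2 (Fin n)))} {G} (hG : G ∈ F) :
    upIndicator F G = 1 :=
  upIndicator_eq_one_iff.mpr ⟨G, hG, subset_rfl⟩

lemma upIndicator_mono (F : Finset (Finset (Sym2 (Fin n)))) : Monotone (upIndicator F) := by
  intro x y hxy
  rcases upIndicator_eq_zero_or_one F x with h | h
  · rcases upIndicator_eq_zero_or_one F y with h' | h' <;> simp [h, h']
  · obtain ⟨G, hG, hGx⟩ := upIndicator_eq_one_iff.mp h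
    rw [h, upIndicator_eq_one_iff.mpr ⟨G, hG, hGx.trans hxy⟩]

/-- The up-closure only depends on coordinates used by the family. -/
lemma upIndicator_congr {F : Finset (Finset (Sym2 (Fin n)))} {U x y : Finset (Sym2 (Fin n))}
    (hF : F ⊆ U.powerset) (h : ∀ e ∈ U, (e ∈ x ↔ e ∈ y)) : upIndicator F x = upIndicator F y := by
  have : (∃ G ∈ F, G ⊆ x) ↔ ∃ G ∈ F, G ⊆ y := by
    refine exists_congr fun G => and_congr_right fun hG => ?_
    have hGU := Finset.mem_powerset.mp (hF hG)
    exact ⟨fun hx e he => (h e (hGU he)).mp (hx he), fun hy e he => (h e (hGU he)).mpr (hy he)⟩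
  unfold upIndicator
  simp only [this]

lemma muPFam_le_biased {p : ℝ} (h0 : 0 ≤ p) (h1 : p ≤ 1) {F : Finset (Finset (Sym2 (Fin n)))}
    (hF : F ⊆ (edgeFinset n).powerset) {f : Finset (Sym2 (Fin n)) → ℝ} (hf0 : ∀ x, 0 ≤ f x)
    (hf : ∀ x ∈ F, 1 ≤ f x) : muPFam n p F ≤ biased (edgeFinset n) p f := by
  have h2 : 0 ≤ 1 - p := by linarith
  unfold muPFam biased muP
  rw [card_edgeFinset]
  calc ∑ x ∈ F, p ^ x.card * (1 - p) ^ (n.choose 2 - x.card)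
      ≤ ∑ x ∈ F, p ^ x.card * (1 - p) ^ (n.choose 2 - x.card) * f x :=
        Finset.sum_le_sum fun x hx => le_mul_of_one_le_right (by positivity) (hf x hx)
    _ ≤ _ := Finset.sum_le_sum_of_subset_of_nonneg hF fun x _ _ =>
        mul_nonneg (by positivity) (hf0 x)

lemma muPFam_le_one {p : ℝ} (h0 : 0 ≤ p) (h1 : p ≤ 1) {F : Finset (Finset (Sym2 (Fin n)))}
    (hF : F ⊆ (edgeFinset n).powerset) : muPFam n p F ≤ 1 :=
  (muPFam_le_biased h0 h1 hF (f := fun _ => 1) (by simp) (by simp)).trans_eq (biased_one _ _)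

lemma muPFam_inter_add_sdiff (p : ℝ) (F H : Finset (Finset (Sym2 (Fin n)))) :
    muPFam n p (F ∩ H) + muPFam n p (F \ H) = muPFam n p F :=
  Finset.sum_inter_add_sum_sdiff F H _

lemma muPFam_union {F H : Finset (Finset (Sym2 (Fin n)))} (p : ℝ) (h : Disjoint F H) :
    muPFam n p (F ∪ H) = muPFam n p F + muPFam n p H :=
  Finset.sum_union h

lemma notMem_edgeFinset {e : Sym2 (Fin n)} : e ∉ edgeFinset n ↔ e.IsDiag := by
  simp [edgeFinset]

/-- The members of a family avoiding some edge of `T` have small biased measure as soon as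
they have small uniform measure. -/
lemma muPFam_sdiff_le {s : ℝ} (hs : 1 ≤ s) {F : Finset (Finset (Sym2 (Fin n)))}
    (hF : F ⊆ (edgeFinset n).powerset) (T : Finset (Sym2 (Fin n))) :
    muPFam n ((1 / 2) ^ s) (F \ (edgeFinset n).powerset.filter fun G => T ⊆ G) ≤
      T.card * (2 * avg fun x => if T ⊆ x then 0 else upIndicator F x) := by
  have hp0 : (0 : ℝ) ≤ (1 / 2) ^ s := by positivity
  have hp1 : ((1 : ℝ) / 2) ^ s ≤ 1 := Real.rpow_le_one (by norm_num) (by norm_num) (by linarith)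
  have hnonneg : ∀ x, 0 ≤ upIndicator F x := fun x => by
    rcases upIndicator_eq_zero_or_one F x with h | h <;> simp [h]
  refine (muPFam_le_biased hp0 hp1 (Finset.sdiff_subset.trans hF)
    (f := fun x => ∑ e ∈ T, upIndicator F (x.erase e))
    (fun x => Finset.sum_nonneg fun e _ => hnonneg _) ?_).trans ?_
  · intro x hx
    obtain ⟨hxF, hxT⟩ := Finset.mem_sdiff.mp hx
    have hTx : ¬T ⊆ x := fun h => hxT (Finset.mem_filter.mpr ⟨hF hxF, h⟩)
    obtain ⟨e, heT, hex⟩ := Finset.not_subset.mp hTx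
    refine le_trans ?_ (Finset.single_le_sum (fun e _ => hnonneg (x.erase e)) heT)
    rw [Finset.erase_eq_of_notMem hex, upIndicator_of_mem hxF]
  · rw [biased_sum, ← nsmul_eq_mul]
    refine Finset.sum_le_card_nsmul _ _ _ fun e he => ?_
    have h1 := biased_le_avg_rpow hs (edgeFinset n) (f := fun x => upIndicator F (x.erase e))
      (fun x => upIndicator_eq_zero_or_one F _)
      (fun x y hxy => upIndicator_mono F (Finset.erase_subset_erase e hxy)) (by
        intro a ha x
        refine upIndicator_congr hF fun b hb => ?_
        have hba : b ≠ a := fun h => ha (h ▸ hb)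
        simp [hba])
    have h2 : avg (fun x => upIndicator F (x.erase e)) ≤ 1 := by
      refine (avg_mono fun x => ?_).trans_eq (avg_const 1)
      rcases upIndicator_eq_zero_or_one F (x.erase e) with h | h <;> simp [h]
    have h3 : 0 ≤ avg (fun x => upIndicator F (x.erase e)) := avg_nonneg fun x => hnonneg _
    have h4 := Real.rpow_le_self_of_le_one h3 h2 hs
    refine (h1.trans h4).trans ?_
    rw [avg_erase]
    refine mul_le_mul_of_nonneg_left (avg_mono fun x => ?_) (by norm_num)
    by_cases hex : e ∈ x
    · rw [if_pos hex]
      split_ifs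
      · exact le_rfl
      · exact hnonneg x
    · rw [if_neg hex, if_neg fun h => hex (h he)]

lemma muPFam_filter_superset_le {s : ℝ} (hs : 1 ≤ s) {T : Finset (Sym2 (Fin n))}
    (hT : IsTriangle T) :
    muPFam n ((1 / 2) ^ s) ((edgeFinset n).powerset.filter fun G => T ⊆ G) ≤
      (1 / 8) ^ s := by
  have hp0 : (0 : ℝ) ≤ (1 / 2) ^ s := by positivity
  have hp1 : ((1 : ℝ) / 2) ^ s ≤ 1 := Real.rpow_le_one (by norm_num) (by norm_num) (by linarith)
  refine (muPFam_le_biased hp0 hp1 (Finset.filter_subset _ _)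
    (f := fun x => if T ⊆ x then 1 else 0) (fun x => by split_ifs <;> norm_num) ?_).trans ?_
  · intro x hx
    rw [if_pos (Finset.mem_filter.mp hx).2]
  · refine (biased_le_avg_rpow hs (edgeFinset n) (fun x => ?_) ?_ ?_).trans_eq ?_
    · split_ifs <;> simp
    · intro x y hxy
      by_cases h : T ⊆ x
      · simp [h, h.trans hxy]
      · simp only [h, if_false]
        split_ifs <;> norm_num
    · intro e he x
      have heT : e ∉ T := fun h => hT.not_isDiag e h (notMem_edgeFinset.mp he)
      simp only [Finset.subset_insert_iff_of_notMem heT]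
    · rw [avg_superset, hT.card_eq]
      norm_num

end Assembly

theorem odd_cycle_intersecting_stability
    (δ : ℝ) (hδ0 : 0 < δ) (hδ : δ ≤ 1 / 2) :
    ∃ c : ℝ, 0 < c ∧
      ∀ p : ℝ, δ ≤ p → p ≤ 1 / 2 →
        ∀ (n : ℕ), 3 ≤ n → ∀ ε : ℝ, 0 ≤ ε →
          ∀ F : Finset (Finset (Sym2 (Fin n))),
            F ⊆ (edgeFinset n).powerset →
            OddCycleIntersecting F →
            muPFam n p F ≥ p ^ 3 - ε →
            ∃ T : Finset (Sym2 (Fin n)), IsTriangle T ∧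
              muPFam n p
                ((F \ (edgeFinset n).powerset.filter (fun G => T ⊆ G)) ∪
                  ((edgeFinset n).powerset.filter (fun G => T ⊆ G) \ F))
                ≤ c * ε := by
  obtain ⟨θ₀, hθ₀, C, hC, hmain⟩ := exists_triangle_of_odd_cycle_intersecting
  refine ⟨1 / (8 * δ ^ 3 * θ₀) + (1 + 12 * C / (8 * δ ^ 3)), by positivity, ?_⟩
  intro p hp hp2 n hn ε hε F hF hodd hμ
  have hp0 : 0 < p := hδ0.trans_le hp
  obtain ⟨s, hs, rfl⟩ : ∃ s : ℝ, 1 ≤ s ∧ (1 / 2 : ℝ) ^ s = p := by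
    have h := Real.rpow_logb (by norm_num : (0 : ℝ) < 1 / 2) (by norm_num) hp0
    refine ⟨Real.logb (1 / 2) p, ?_, h⟩
    rw [← Real.rpow_le_rpow_left_iff_of_base_lt_one (by norm_num : (0 : ℝ) < 1 / 2) (by norm_num),
      h, Real.rpow_one]
    exact hp2
  have hp1 : ((1 : ℝ) / 2) ^ s ≤ 1 := by linarith
  set f := upIndicator F with hf
  have hf01 := upIndicator_eq_zero_or_one F
  have hf0 : ∀ x, 0 ≤ f x := fun x => by rcases hf01 x with h | h <;> rw [hf, h]; norm_num
  obtain ⟨havg8, hT⟩ := hmain n f hf01 (upIndicator_mono F)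
    (by
      intro e he x
      refine upIndicator_congr hF fun a ha => ?_
      have hae : a ≠ e := fun h => notMem_edgeFinset.mpr he (h ▸ ha)
      simp [Finset.mem_symmDiff, hae])
    (by
      intro x y hx hy
      obtain ⟨G, hG, hGx⟩ := upIndicator_eq_one_iff.mp hx
      obtain ⟨H, hH, hHy⟩ := upIndicator_eq_one_iff.mp hy
      exact (hodd G hG H hH).mono (Finset.inter_subset_inter hGx hHy))
  have havg0 : 0 ≤ BooleanCube.avg f := BooleanCube.avg_nonneg hf0
  have hcube : ((1 / 2 : ℝ) ^ s) ^ 3 = (1 / 8) ^ s := by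
    rw [← Real.rpow_natCast, ← Real.rpow_mul (by norm_num), mul_comm, Real.rpow_mul (by norm_num)]
    norm_num
  have hFavg : muPFam n ((1 / 2) ^ s) F ≤ BooleanCube.avg f ^ s := by
    refine (muPFam_le_biased hp0.le hp1 hF hf0 fun x hx => (upIndicator_of_mem hx).ge).trans ?_
    refine BooleanCube.biased_le_avg_rpow hs _ hf01 (upIndicator_mono F) fun e he x => ?_
    refine upIndicator_congr hF fun a ha => ?_
    have hae : a ≠ e := fun h => he (h ▸ ha)
    simp [hae]
  have hpow : BooleanCube.avg f ^ s ≤ (1 / 8) ^ s * (8 * BooleanCube.avg f) := by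
    have h1 : BooleanCube.avg f = 1 / 8 * (8 * BooleanCube.avg f) := by ring
    have h2 := Real.rpow_le_self_of_le_one (by linarith : 0 ≤ 8 * BooleanCube.avg f) (by linarith) hs
    calc BooleanCube.avg f ^ s = (1 / 8 * (8 * BooleanCube.avg f)) ^ s := by rw [← h1]
      _ = (1 / 8) ^ s * (8 * BooleanCube.avg f) ^ s := Real.mul_rpow (by norm_num) (by linarith)
      _ ≤ _ := mul_le_mul_of_nonneg_left h2 (by positivity)
  have hδ3 : 0 < 8 * δ ^ 3 := by positivity
  have hε' : 8 * δ ^ 3 * (1 / 8 - BooleanCube.avg f) ≤ ε := by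
    have h1 : δ ^ 3 ≤ (1 / 8) ^ s := hcube ▸ pow_le_pow_left₀ hδ0.le hp 3
    rw [hcube] at hμ
    nlinarith
  by_cases hθ : 1 / 8 - BooleanCube.avg f ≤ θ₀
  · obtain ⟨T, hT, hTavg⟩ := hT hθ
    refine ⟨T, hT, ?_⟩
    have h1 := muPFam_sdiff_le hs hF T
    rw [hT.card_eq] at h1
    have h2 := muPFam_filter_superset_le hs hT
    set 𝒯 := (edgeFinset n).powerset.filter fun G => T ⊆ G
    have h3 := muPFam_inter_add_sdiff ((1 / 2) ^ s) F 𝒯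
    have h4 := muPFam_inter_add_sdiff ((1 / 2) ^ s) 𝒯 F
    rw [Finset.inter_comm] at h4
    have hdisj : Disjoint (F \ 𝒯) (𝒯 \ F) := disjoint_sdiff_sdiff
    rw [muPFam_union _ hdisj]
    have h5 : 12 * C * (1 / 8 - BooleanCube.avg f) ≤ 12 * C / (8 * δ ^ 3) * ε := by
      rw [div_mul_eq_mul_div, le_div_iff₀ hδ3]
      have := mul_le_mul_of_nonneg_left hε' (by positivity : 0 ≤ 12 * C)
      linarith
    have h6 : 0 ≤ 1 / (8 * δ ^ 3 * θ₀) * ε := by positivity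
    push_cast at h1
    rw [hcube] at hμ
    linarith
  · obtain ⟨T, hT⟩ := exists_isTriangle hn
    refine ⟨T, hT, (muPFam_le_one hp0.le hp1 ?_).trans ?_⟩
    · exact Finset.union_subset (Finset.sdiff_subset.trans hF)
        (Finset.sdiff_subset.trans (Finset.filter_subset _ _))
    · have h1 : 8 * δ ^ 3 * θ₀ ≤ ε :=
        (mul_le_mul_of_nonneg_left (not_le.mp hθ).le hδ3.le).trans hε'
      have h2 : 1 ≤ 1 / (8 * δ ^ 3 * θ₀) * ε := by
        rw [div_mul_eq_mul_div, one_mul, le_div_iff₀ (by positivity)]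
        linarith
      have h3 : 0 ≤ (1 + 12 * C / (8 * δ ^ 3)) * ε := by positivity
      linarith
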